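/- There exists a locally uncountable dense set A ⊆ [√2, 2] of parameters such that for every a ∈ A, the tent map T_a restricted to ω(c) is a homeomorphism of ω(c) onto itself, where ω(c) is an infinite compact set. -/

import Mathlib

/-- The tent map with slope `a`. -/
noncomputable def tent (a x : ℝ) : ℝ := min (a * x) (a * (1 - x))

/-- The omega-limit set `ω(x) = ⋂_i closure (⋃_{j ≥ i} f^j(x))`. -/
def omegaSet (f : ℝ → ℝ) (x : ℝ) : Set ℝ :=
  ⋂ i : ℕ, closure {y | ∃ j : ℕ, i ≤ j ∧ f^[j] x = y}

namespace TentAux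

/-- orbit of the turning point -/
noncomputable def xi (a : ℝ) (i : ℕ) : ℝ := (tent a)^[i] (1/2)

lemma tent_eq {a : ℝ} (ha : 0 ≤ a) (x : ℝ) : tent a x = a/2 - a*|x-1/2| := by
  unfold tent
  rcases le_total x (1/2) with h | h
  · rw [abs_of_nonpos (by linarith), min_eq_left (by nlinarith)]; ring
  · rw [abs_of_nonneg (by linarith), min_eq_right (by nlinarith)]; ring

lemma iter_cont (k : ℕ) : Continuous fun p : ℝ × ℝ => (tent p.1)^[k] p.2 := by
  induction k with
  | zero => simpa using continuous_snd
  | succ k ih =>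
    simp only [Function.iterate_succ_apply']
    unfold tent at *
    fun_prop

lemma xi_cont (k : ℕ) : Continuous fun a : ℝ => xi a k := by
  unfold xi
  exact (iter_cont k).comp (by fun_prop : Continuous fun a : ℝ => (a, (1/2 : ℝ)))

lemma iter_cont' (a : ℝ) (k : ℕ) : Continuous (tent a)^[k] :=
  (iter_cont k).comp (by fun_prop : Continuous fun x : ℝ => (a, x))

lemma xi_add (a : ℝ) (i j : ℕ) : xi a (i + j) = (tent a)^[i] (xi a j) := by
  unfold xi; rw [Function.iterate_add_apply]

lemma xi_zero (a : ℝ) : xi a 0 = 1/2 := rfl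

lemma xi_one {a : ℝ} (ha : 0 ≤ a) : xi a 1 = a/2 := by
  simp [xi, tent_eq ha]

lemma tent_lip {a : ℝ} (ha : 0 ≤ a) (x y : ℝ) : |tent a x - tent a y| ≤ a * |x - y| := by
  rw [tent_eq ha, tent_eq ha]
  have : a/2 - a*|x-1/2| - (a/2 - a*|y-1/2|) = a * (|y-1/2| - |x-1/2|) := by ring
  rw [this, abs_mul, abs_of_nonneg ha]
  apply mul_le_mul_of_nonneg_left _ ha
  calc _ ≤ |(y-1/2) - (x-1/2)| := abs_abs_sub_abs_le _ _
    _ = |x - y| := by rw [abs_sub_comm]; congr 1; ring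

lemma iter_lip {a : ℝ} (ha : 0 ≤ a) (k : ℕ) (x y : ℝ) :
    |(tent a)^[k] x - (tent a)^[k] y| ≤ a^k * |x - y| := by
  induction k with
  | zero => simp
  | succ k ih =>
    simp only [Function.iterate_succ_apply']
    refine (tent_lip ha _ _).trans ?_
    rw [pow_succ, mul_comm (a^k) a, mul_assoc]
    exact mul_le_mul_of_nonneg_left ih ha

lemma tent_mem {a x : ℝ} (ha : 0 ≤ a) (ha2 : a ≤ 2) (hx : x ∈ Set.Icc (0:ℝ) 1) :
    tent a x ∈ Set.Icc (0:ℝ) 1 := by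
  rw [tent_eq ha]
  have h1 : |x - 1/2| ≤ 1/2 := by rw [abs_le]; constructor <;> linarith [hx.1, hx.2]
  have h2 := abs_nonneg (x - 1/2)
  constructor <;> nlinarith

lemma iter_mem {a x : ℝ} (ha : 0 ≤ a) (ha2 : a ≤ 2) (hx : x ∈ Set.Icc (0:ℝ) 1) (k : ℕ) :
    (tent a)^[k] x ∈ Set.Icc (0:ℝ) 1 := by
  induction k with
  | zero => simpa using hx
  | succ k ih =>
    simp only [Function.iterate_succ_apply']
    exact tent_mem ha ha2 ih

lemma xi_mem {a : ℝ} (ha : 0 ≤ a) (ha2 : a ≤ 2) (k : ℕ) : xi a k ∈ Set.Icc (0:ℝ) 1 :=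
  iter_mem ha ha2 (by norm_num) k

lemma tent_symm {a : ℝ} (ha : 0 ≤ a) (x : ℝ) : tent a (1/2 + x) = tent a (1/2 - x) := by
  rw [tent_eq ha, tent_eq ha]
  simp

noncomputable def sgn1 (x : ℝ) : ℝ := if x < 1/2 then 1 else -1

noncomputable def sg (a p : ℝ) (k : ℕ) : ℝ := ∏ i ∈ Finset.range k, sgn1 ((tent a)^[i] p)

lemma sgn1_cases (x : ℝ) : sgn1 x = 1 ∨ sgn1 x = -1 := by
  unfold sgn1; split_ifs <;> simp

lemma sg_cases (a p : ℝ) (k : ℕ) : sg a p k = 1 ∨ sg a p k = -1 := by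
  unfold sg
  induction k with
  | zero => simp
  | succ k ih =>
    rw [Finset.prod_range_succ]
    rcases ih with h | h <;> rcases sgn1_cases ((tent a)^[k] p) with h' | h' <;> rw [h, h'] <;> norm_num

lemma affine {a : ℝ} (ha : 0 ≤ a) (k : ℕ) (p q : ℝ)
    (h : ∀ i < k, 0 < ((tent a)^[i] p - 1/2) * ((tent a)^[i] q - 1/2)) :
    (tent a)^[k] p - (tent a)^[k] q = sg a q k * a^k * (p - q) := by
  induction k with
  | zero => simp [sg]
  | succ k ih =>
    have ih' := ih (fun i hi => h i (by omega))
    have hk := h k (by omega)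
    simp only [Function.iterate_succ_apply']
    have e : sg a q (k+1) = sg a q k * sgn1 ((tent a)^[k] q) := by
      unfold sg; rw [Finset.prod_range_succ]
    rw [e, tent_eq ha, tent_eq ha]
    set P := (tent a)^[k] p
    set Q := (tent a)^[k] q
    have : |Q - 1/2| - |P - 1/2| = sgn1 Q * (P - Q) := by
      unfold sgn1
      split_ifs with hq
      · have hp : P < 1/2 := by nlinarith
        rw [abs_of_neg (by linarith), abs_of_neg (by linarith)]; ring
      · have hp : 1/2 < P := by
          by_contra hc
          push Not at hc hq
          nlinarith
        rw [abs_of_nonneg (by linarith), abs_of_pos (by linarith)]; ring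
    calc _ = a * (|Q - 1/2| - |P - 1/2|) := by ring
      _ = a * (sgn1 Q * (P - Q)) := by rw [this]
      _ = _ := by rw [ih']; ring

lemma fold {a : ℝ} (ha : 0 ≤ a) (n : ℕ) (hn : 0 < n) (x : ℝ)
    (h : ∀ l, 0 < l → l < n → 0 < ((tent a)^[l] (1/2 + x) - 1/2) * (xi a l - 1/2)) :
    (tent a)^[n] (1/2 + x) = xi a n - sg a (a/2) (n-1) * a^n * |x| := by
  obtain ⟨m, rfl⟩ : ∃ m, n = m + 1 := ⟨n - 1, by omega⟩
  have key := affine ha m (tent a (1/2 + x)) (a/2) (by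
    intro i hi
    have := h (i+1) (by omega) (by omega)
    rwa [Function.iterate_succ_apply, xi_add, xi_one ha] at this)
  rw [Function.iterate_succ_apply, xi_add, xi_one ha]
  simp only [Nat.add_sub_cancel]
  have e : tent a (1/2 + x) - a/2 = - a * |x| := by rw [tent_eq ha]; simp
  rw [e] at key
  rw [pow_succ]
  linarith

/-- same side from closeness -/
lemma same_side {x y r : ℝ} (h1 : |x - y| ≤ r) (h2 : r < |y - 1/2|) :
    0 < (x - 1/2) * (y - 1/2) := by
  rcases abs_cases (x - y) with h | h <;> rcases abs_cases (y - 1/2) with h' | h' <;> nlinarith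

/-- odometer structure of the critical orbit -/
def Good (a : ℝ) : Prop :=
  ∀ N : ℕ, ∀ ε > 0, ∃ n : ℕ, ∃ D1 D2 : ℝ, N < n ∧ D1 < D2 ∧
    (∀ i, n ∣ i → |xi a i - 1/2| ≤ D1) ∧ (∀ i, ¬ n ∣ i → D2 ≤ |xi a i - 1/2|) ∧
    (∀ i j, i ≡ j [MOD n] → |xi a i - xi a j| ≤ ε)

lemma gap {a : ℝ} (ha : 1 ≤ a) {n : ℕ} (hn : 0 < n) {D1 D2 : ℝ}
    (h1 : ∀ i, n ∣ i → |xi a i - 1/2| ≤ D1) (h2 : ∀ i, ¬ n ∣ i → D2 ≤ |xi a i - 1/2|)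
    {i j : ℕ} (hij : ¬ i ≡ j [MOD n]) : D2 - D1 ≤ a^n * |xi a i - xi a j| := by
  obtain ⟨t, ht, hd⟩ : ∃ t ≤ n, n ∣ t + i := by
    refine ⟨n - i % n, by omega, ?_⟩
    have := Nat.mod_lt i hn
    have h3 := Nat.div_add_mod i n
    exact ⟨i / n + 1, by rw [mul_add]; omega⟩
  have hd' : ¬ n ∣ t + j := by
    intro h
    apply hij
    have : t + i ≡ t + j [MOD n] := by
      rw [Nat.ModEq, Nat.mod_eq_zero_of_dvd hd, Nat.mod_eq_zero_of_dvd h]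
    exact Nat.ModEq.add_left_cancel' t this
  have e1 := h1 _ hd
  have e2 := h2 _ hd'
  have e3 := iter_lip (by linarith : 0 ≤ a) t (xi a i) (xi a j)
  rw [← xi_add, ← xi_add] at e3
  have e4 : a^t * |xi a i - xi a j| ≤ a^n * |xi a i - xi a j| :=
    mul_le_mul_of_nonneg_right (pow_le_pow_right₀ ha ht) (abs_nonneg _)
  have e5 : |xi a (t+j) - 1/2| ≤ |xi a (t+i) - 1/2| + |xi a (t+i) - xi a (t+j)| := by
    rw [abs_sub_comm (xi a (t+i)) (xi a (t+j))]
    have := abs_sub_le (xi a (t+j)) (xi a (t+i)) (1/2)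
    linarith
  linarith

lemma good_concl {a : ℝ} (ha : 1 ≤ a) (ha2 : a ≤ 2) (hg : Good a) :
    (omegaSet (tent a) (1 / 2)).Infinite ∧
        IsCompact (omegaSet (tent a) (1 / 2)) ∧
        ∃ h : ↥(omegaSet (tent a) (1 / 2)) ≃ₜ ↥(omegaSet (tent a) (1 / 2)),
          ∀ x : ↥(omegaSet (tent a) (1 / 2)), (h x : ℝ) = tent a x := by
  have ha0 : 0 ≤ a := by linarith
  set Ω := omegaSet (tent a) (1 / 2) with hΩ
  have memΩ : ∀ x, x ∈ Ω ↔ ∀ N : ℕ, ∀ ε > 0, ∃ j, N ≤ j ∧ |xi a j - x| < ε := by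
    intro x
    simp only [hΩ, omegaSet, Set.mem_iInter, Metric.mem_closure_iff, Set.mem_ofPred_eq]
    refine forall_congr' fun N => forall_congr' fun ε => forall_congr' fun hε => ?_
    constructor
    · rintro ⟨_, ⟨j, hj, rfl⟩, h⟩
      exact ⟨j, hj, by rw [abs_sub_comm]; exact h⟩
    · rintro ⟨j, hj, h⟩
      exact ⟨_, ⟨j, hj, rfl⟩, by rw [abs_sub_comm] at h; exact h⟩
  have xiΩ : ∀ i, xi a i ∈ Ω := by
    intro i
    rw [memΩ]
    intro N ε hε
    obtain ⟨n, D1, D2, hn, -, -, -, h⟩ := hg N (ε/2) (by linarith)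
    refine ⟨i + n, by omega, ?_⟩
    have := h (i+n) i (by simp [Nat.ModEq])
    linarith
  have hinj : Function.Injective (xi a) := by
    intro i j hij
    by_contra hne
    obtain ⟨n, D1, D2, hn, hD, h1, h2, -⟩ := hg (i+j) 1 (by norm_num)
    have := gap ha (by omega) h1 h2 (i := i) (j := j) (by
      intro h
      have := Nat.ModEq.eq_of_lt_of_lt h (by omega) (by omega)
      exact hne this)
    rw [hij] at this
    simp at this
    linarith
  have hclosed : IsClosed Ω := isClosed_iInter fun i => isClosed_closure
  have hsub : Ω ⊆ Set.Icc 0 1 := by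
    intro x hx
    have : x ∈ closure {y | ∃ j : ℕ, 0 ≤ j ∧ (tent a)^[j] (1/2) = y} := Set.mem_iInter.1 hx 0
    refine closure_minimal ?_ isClosed_Icc this
    rintro _ ⟨j, -, rfl⟩
    exact xi_mem ha0 ha2 j
  have hcomp : IsCompact Ω := isCompact_Icc.of_isClosed_subset hclosed hsub
  have hcont : Continuous (tent a) := by simpa using iter_cont' a 1
  have hsucc : ∀ i, tent a (xi a i) = xi a (i+1) := by
    intro i; rw [xi, xi, Function.iterate_succ_apply']
  have hmaps : ∀ x ∈ Ω, tent a x ∈ Ω := by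
    intro x hx
    rw [memΩ] at hx ⊢
    intro N ε hε
    obtain ⟨j, hj, h⟩ := hx N (ε/3) (by linarith)
    refine ⟨j+1, by omega, ?_⟩
    rw [← hsucc]
    have := tent_lip ha0 (xi a j) x
    nlinarith [abs_nonneg (xi a j - x)]
  refine ⟨Set.infinite_of_injective_forall_mem hinj xiΩ, hcomp, ?_⟩
  have hI : ∀ x ∈ Ω, ∀ y ∈ Ω, tent a x = tent a y → x = y := by
    intro x hx y hy hxy
    rw [memΩ] at hx hy
    by_contra hne
    have hpos : 0 < |x - y| := abs_pos.2 (sub_ne_zero.2 hne)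
    obtain ⟨n, D1, D2, hn, hD, h1, h2, h3⟩ := hg 0 (|x-y|/4) (by linarith)
    have hP : 0 < a^n := by positivity
    obtain ⟨δ, hδ, hδ1, hδ2⟩ : ∃ δ > 0, δ ≤ |x-y|/4 ∧ a^n * (4 * δ) < D2 - D1 := by
      refine ⟨min (|x-y|/4) ((D2-D1)/(8*a^n)), lt_min (by linarith) (by apply div_pos <;> linarith), min_le_left _ _, ?_⟩
      have := min_le_right (|x-y|/4) ((D2-D1)/(8*a^n))
      rw [le_div_iff₀ (by positivity)] at this
      nlinarith
    obtain ⟨i, -, hi⟩ := hx 0 δ hδ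
    obtain ⟨j, -, hj⟩ := hy 0 δ hδ
    have hmod : i + 1 ≡ j + 1 [MOD n] := by
      by_contra hc
      have g := gap ha (by omega) h1 h2 hc
      rw [← hsucc, ← hsucc] at g
      have e1 := tent_lip ha0 (xi a i) x
      have e2 := tent_lip ha0 (xi a j) y
      rw [hxy] at e1
      have e3 : |tent a (xi a i) - tent a (xi a j)| ≤ 4 * δ := by
        have := abs_sub_le (tent a (xi a i)) (tent a y) (tent a (xi a j))
        rw [abs_sub_comm (tent a y)] at this
        nlinarith [abs_nonneg (xi a i - x), abs_nonneg (xi a j - y)]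
      nlinarith
    have h4 := h3 i j (Nat.ModEq.add_right_cancel' 1 hmod)
    have h5 : |x - y| ≤ |xi a i - x| + |xi a i - xi a j| + |xi a j - y| := by
      have := abs_sub_le x (xi a i) y
      have := abs_sub_le (xi a i) (xi a j) y
      rw [abs_sub_comm (xi a i) x]
      linarith
    linarith
  have hS : ∀ y ∈ Ω, ∃ x ∈ Ω, tent a x = y := by
    intro y hy
    have hc : IsClosed (tent a '' Ω) := (hcomp.image hcont).isClosed
    have : y ∈ closure {y | ∃ j : ℕ, 1 ≤ j ∧ (tent a)^[j] (1/2) = y} := Set.mem_iInter.1 hy 1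
    refine closure_minimal ?_ hc this
    rintro _ ⟨j, hj, rfl⟩
    refine ⟨xi a (j-1), xiΩ _, ?_⟩
    rw [hsucc, Nat.sub_add_cancel hj]; rfl
  let F : Ω → Ω := fun x => ⟨tent a x, hmaps x x.2⟩
  have hF : Function.Bijective F := by
    constructor
    · intro x y h
      exact Subtype.ext (hI x x.2 y y.2 (congrArg Subtype.val h))
    · intro y
      obtain ⟨x, hx, h⟩ := hS y y.2
      exact ⟨⟨x, hx⟩, Subtype.ext h⟩
  have hFc : Continuous (Equiv.ofBijective F hF) := by
    change Continuous F
    exact (hcont.comp continuous_subtype_val).subtype_mk _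
  have : CompactSpace Ω := isCompact_iff_compactSpace.1 hcomp
  exact ⟨hFc.homeoOfEquivCompactToT2, fun x => rfl⟩

structure Weak (a : ℝ) (n M : ℕ) (τ d : ℝ) : Prop where
  ha : Real.sqrt 2 < a
  ha2 : a < 2
  hn : 0 < n
  hM : 0 < M
  hτ : τ = 1 ∨ τ = -1
  hd : 0 < d
  per : xi a n = 1/2
  w2 : ∀ l, 0 < l → l < n → d ≤ |xi a l - 1/2|
  w3 : (tent a)^[M] (1/2 + τ * d) = 1/2
  w4 : ∀ l < M, (tent a)^[l] (1/2 + τ * d) ≠ 1/2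
  w5 : ∀ ε > 0, ∃ t, |t - a| < ε ∧ τ * (xi t n - 1/2) < 0
  w6 : (tent a)^[n] (1/2 + τ * (d / a^n)) = 1/2 + τ * d
  w7 : 4 < a^n

structure Strong (a : ℝ) (n : ℕ) (τ d η : ℝ) : Prop where
  weak : Weak a n n τ d
  s1 : ∀ l, 0 < l → l < n → 2 * d ≤ |xi a l - 1/2|
  s2 : ∀ l, 0 < l → l < n → 2 * d ≤ |(tent a)^[l] (1/2 + τ * d) - 1/2|
  s3 : ∀ l ≤ n, |(tent a)^[l] (1/2 + τ * d) - xi a l| ≤ η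

lemma exists_pos_lb (f : ℕ → ℝ) (M : ℕ) (h : ∀ l < M, 0 < f l) : ∃ m > 0, ∀ l < M, m ≤ f l := by
  induction M with
  | zero => exact ⟨1, by norm_num, by simp⟩
  | succ M ih =>
    obtain ⟨m, hm, h1⟩ := ih (fun l hl => h l (by omega))
    refine ⟨min m (f M), lt_min hm (h M (by omega)), fun l hl => ?_⟩
    rcases Nat.lt_succ_iff_lt_or_eq.1 hl with h2 | rfl
    · exact (min_le_left _ _).trans (h1 l h2)
    · exact min_le_right _ _

lemma joint (a u κ : ℝ) (hκ : 0 < κ) (M : ℕ) : ∃ δ > 0, ∀ t z, |t - a| < δ → |z - u| < δ →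
    ∀ l ≤ M, |(tent t)^[l] z - (tent a)^[l] u| < κ := by
  have base : ∀ l, ∃ δ > 0, ∀ t z, |t - a| < δ → |z - u| < δ →
      |(tent t)^[l] z - (tent a)^[l] u| < κ := by
    intro l
    obtain ⟨δ, hδ, h⟩ := Metric.continuousAt_iff.1 ((iter_cont l).continuousAt (x := (a, u))) κ hκ
    refine ⟨δ, hδ, fun t z ht hz => ?_⟩
    have := @h (t, z) (by rw [Prod.dist_eq]; exact max_lt ht hz)
    exact this
  choose δ hδ h using base
  obtain ⟨m, hm, h1⟩ := exists_pos_lb δ (M+1) (fun l _ => hδ l)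
  exact ⟨m, hm, fun t z ht hz l hl => h l t z (ht.trans_le (h1 l (by omega))) (hz.trans_le (h1 l (by omega)))⟩

lemma sgn1_congr {x y : ℝ} (h : 0 < (x - 1/2) * (y - 1/2)) : sgn1 x = sgn1 y := by
  unfold sgn1
  split_ifs with h1 h2 h2
  · rfl
  · push Not at h2; nlinarith
  · push Not at h1; nlinarith
  · rfl

lemma sg_congr {a b p q : ℝ} {k : ℕ}
    (h : ∀ i < k, 0 < ((tent a)^[i] p - 1/2) * ((tent b)^[i] q - 1/2)) : sg a p k = sg b q k := by
  unfold sg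
  exact Finset.prod_congr rfl fun i hi => sgn1_congr (h i (Finset.mem_range.1 hi))

lemma sg_congr_xi {a b : ℝ} (ha : 0 ≤ a) (hb : 0 ≤ b) {n : ℕ}
    (h : ∀ l, 0 < l → l < n → 0 < (xi a l - 1/2) * (xi b l - 1/2)) :
    sg a (a/2) (n-1) = sg b (b/2) (n-1) := by
  apply sg_congr
  intro i hi
  have := h (i+1) (by omega) (by omega)
  rwa [xi_add, xi_add, xi_one ha, xi_one hb] at this

lemma subseg_aux (g : ℝ → ℝ) (hg : Continuous g) (a b α β : ℝ) (hab : a ≤ b) (hαβ : α < β)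
    (h1 : g a ≤ α) (h2 : β ≤ g b) : ∃ p q, a ≤ p ∧ p ≤ q ∧ q ≤ b ∧ g p = α ∧ g q = β ∧
      ∀ t, p ≤ t → t ≤ q → α ≤ g t ∧ g t ≤ β := by
  have hc1 : IsCompact (Set.Icc a b ∩ g ⁻¹' Set.Iic α) :=
    isCompact_Icc.inter_right (isClosed_Iic.preimage hg)
  obtain ⟨p, ⟨⟨hp1, hp2⟩, hp3⟩, hp4⟩ := hc1.exists_isGreatest ⟨a, ⟨le_rfl, hab⟩, h1⟩
  have hc2 : IsCompact (Set.Icc p b ∩ g ⁻¹' Set.Ici β) :=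
    isCompact_Icc.inter_right (isClosed_Ici.preimage hg)
  obtain ⟨q, ⟨⟨hq1, hq2⟩, hq3⟩, hq4⟩ := hc2.exists_isLeast ⟨b, ⟨hp2, le_rfl⟩, h2⟩
  simp only [Set.mem_preimage, Set.mem_Iic, Set.mem_Ici] at hp3 hq3
  have hgp : g p = α := by
    obtain ⟨t, ⟨ht1, ht2⟩, ht⟩ := intermediate_value_Icc hp2 hg.continuousOn (show α ∈ Set.Icc (g p) (g b) from ⟨hp3, by linarith⟩)
    have : t ≤ p := hp4 ⟨⟨by linarith, ht2⟩, ht.le⟩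
    rw [← ht, le_antisymm this ht1]
  have hgq : g q = β := by
    obtain ⟨t, ⟨ht1, ht2⟩, ht⟩ := intermediate_value_Icc hq1 hg.continuousOn (show β ∈ Set.Icc (g p) (g q) from ⟨by linarith, hq3⟩)
    have : q ≤ t := hq4 ⟨⟨ht1, by linarith⟩, ht.ge⟩
    rw [← ht, le_antisymm this ht2]
  refine ⟨p, q, hp1, hq1, hq2, hgp, hgq, fun t ht1 ht2 => ⟨?_, ?_⟩⟩
  · by_contra hc
    push Not at hc
    have : t ≤ p := hp4 ⟨⟨by linarith, by linarith⟩, hc.le⟩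
    have : t = p := le_antisymm this ht1
    rw [this, hgp] at hc
    exact lt_irrefl _ hc
  · by_contra hc
    push Not at hc
    have : q ≤ t := hq4 ⟨⟨ht1, by linarith⟩, hc.le⟩
    have : t = q := le_antisymm ht2 this
    rw [this, hgq] at hc
    exact lt_irrefl _ hc

lemma subseg (g : ℝ → ℝ) (hg : Continuous g) (a b α β : ℝ) (hαβ : α < β)
    (h1 : g a ≤ α) (h2 : β ≤ g b) : ∃ p q, Set.uIcc p q ⊆ Set.uIcc a b ∧ g p = α ∧ g q = β ∧
      ∀ t ∈ Set.uIcc p q, α ≤ g t ∧ g t ≤ β := by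
  rcases le_total a b with hab | hab
  · obtain ⟨p, q, e1, e2, e3, e4, e5, e6⟩ := subseg_aux g hg a b α β hab hαβ h1 h2
    refine ⟨p, q, ?_, e4, e5, ?_⟩
    · rw [Set.uIcc_of_le hab, Set.uIcc_of_le e2]
      exact Set.Icc_subset_Icc e1 e3
    · intro t ht
      rw [Set.uIcc_of_le e2] at ht
      exact e6 t ht.1 ht.2
  · obtain ⟨p, q, e1, e2, e3, e4, e5, e6⟩ := subseg_aux (fun t => g (-t)) (hg.comp continuous_neg)
      (-a) (-b) α β (by linarith) hαβ (by simpa using h1) (by simpa using h2)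
    refine ⟨-p, -q, ?_, e4, e5, ?_⟩
    · rw [Set.uIcc_of_ge hab, Set.uIcc_of_ge (by linarith)]
      exact Set.Icc_subset_Icc (by linarith) (by linarith)
    · intro t ht
      rw [Set.uIcc_of_ge (by linarith)] at ht
      have := e6 (-t) (by linarith [ht.2]) (by linarith [ht.1])
      simpa using this

lemma frontier_pt (φ : ℝ → ℝ) (hφ : Continuous φ) (p q : ℝ) (h : φ p * φ q < 0) :
    ∃ a ∈ Set.uIcc p q, φ a = 0 ∧ ∀ ε > 0, ∃ t, |t - a| < ε ∧ 0 < φ t := by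
  by_contra hc
  push Not at hc
  have hu : IsOpen {t | 0 < φ t} := isOpen_lt continuous_const hφ
  have hv : IsOpen (interior {t | φ t ≤ 0}) := isOpen_interior
  have hneg : ∀ t, φ t < 0 → t ∈ interior {t | φ t ≤ 0} := by
    intro t ht
    exact mem_interior.2 ⟨{t | φ t < 0}, fun s hs => (by
      have h1 : φ s < 0 := hs
      exact (show φ s ≤ 0 from h1.le)), isOpen_lt hφ continuous_const, ht⟩
  have hcov : Set.uIcc p q ⊆ {t | 0 < φ t} ∪ interior {t | φ t ≤ 0} := by
    intro t ht
    rcases lt_trichotomy (φ t) 0 with h1 | h1 | h1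
    · exact Or.inr (hneg t h1)
    · obtain ⟨ε, hε, h2⟩ := hc t ht h1
      right
      rw [mem_interior_iff_mem_nhds, Metric.mem_nhds_iff]
      exact ⟨ε, hε, fun s hs => h2 s hs⟩
    · exact Or.inl h1
  have hpq : (Set.uIcc p q ∩ {t | 0 < φ t}).Nonempty ∧
      (Set.uIcc p q ∩ interior {t | φ t ≤ 0}).Nonempty := by
    rcases lt_trichotomy (φ p) 0 with h1 | h1 | h1
    · have : 0 < φ q := by nlinarith
      exact ⟨⟨q, Set.right_mem_uIcc, this⟩, ⟨p, Set.left_mem_uIcc, hneg p h1⟩⟩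
    · rw [h1] at h; simp at h
    · have : φ q < 0 := by nlinarith
      exact ⟨⟨p, Set.left_mem_uIcc, h1⟩, ⟨q, Set.right_mem_uIcc, hneg q this⟩⟩
  obtain ⟨t, -, ht1, ht2⟩ := isPreconnected_uIcc _ _ hu hv hcov hpq.1 hpq.2
  have h3' : t ∈ {t | φ t ≤ 0} := interior_subset ht2
  have h3 : φ t ≤ 0 := h3'
  have h4 : 0 < φ t := ht1
  linarith

lemma same_sign_seg (φ : ℝ → ℝ) (hφ : Continuous φ) (p q : ℝ) (h : ∀ t ∈ Set.uIcc p q, φ t ≠ 0)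
    {s t : ℝ} (hs : s ∈ Set.uIcc p q) (ht : t ∈ Set.uIcc p q) : 0 < φ s * φ t := by
  have key : ∀ s ∈ Set.uIcc p q, ∀ t ∈ Set.uIcc p q, φ s < 0 → ¬ 0 < φ t := by
    intro s hs t ht h1 h2
    obtain ⟨r, hr, h0⟩ := isPreconnected_uIcc.intermediate_value hs ht hφ.continuousOn
      (show (0:ℝ) ∈ Set.Icc (φ s) (φ t) from ⟨h1.le, h2.le⟩)
    exact h r hr h0
  rcases lt_or_gt_of_ne (h s hs) with h1 | h1 <;> rcases lt_or_gt_of_ne (h t ht) with h2 | h2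
  · exact mul_pos_of_neg_of_neg h1 h2
  · exact absurd h2 (key s hs t ht h1)
  · exact absurd h1 (key t ht s hs h2)
  · exact mul_pos h1 h2

lemma sqrt2_lb {t : ℝ} (ht : Real.sqrt 2 < t) : 1.4141 < t := by
  refine lt_of_lt_of_le ?_ ht.le
  rw [Real.lt_sqrt (by norm_num)]; norm_num

lemma near {t : ℝ} (ht : Real.sqrt 2 < t) {l n : ℕ} (hl : l < n) (x : ℝ) :
    |(tent t)^[l] (1/2 + x) - xi t l| ≤ 0.7072 * (t^n * |x|) := by
  have h := sqrt2_lb ht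
  have h1 := iter_lip (by linarith : 0 ≤ t) l (1/2 + x) (1/2)
  rw [add_sub_cancel_left] at h1
  refine h1.trans ?_
  have h2 : t^(l+1) ≤ t^n := pow_le_pow_right₀ (by linarith) hl
  have h3 : 0 < t^l := by positivity
  rw [pow_succ] at h2
  have h4 : t^l ≤ 0.7072 * t^n := by nlinarith
  nlinarith [abs_nonneg x]

/-- escape sequence -/
noncomputable def Y (n : ℕ) (e : ℝ → ℝ) (t : ℝ) : ℕ → ℝ
  | 0 => e t
  | k+1 => t^n * Y n e t k - e t

lemma Y_cont (n : ℕ) (e : ℝ → ℝ) (he : Continuous e) (k : ℕ) : Continuous fun t => Y n e t k := by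
  induction k with
  | zero => simpa [Y] using he
  | succ k ih => simp only [Y]; fun_prop

lemma Y_zero (n : ℕ) (e : ℝ → ℝ) (t : ℝ) (he : e t = 0) (k : ℕ) : Y n e t k = 0 := by
  induction k with
  | zero => simpa [Y] using he
  | succ k ih => simp [Y, ih, he]

lemma Y_grow (n : ℕ) (e : ℝ → ℝ) (t : ℝ) (he : 0 ≤ e t) (ht : 4 < t^n) (k : ℕ) :
    e t ≤ Y n e t k ∧ 3^k * e t ≤ Y n e t k ∧ 3 * Y n e t k ≤ Y n e t (k+1) := by
  have key : ∀ k, e t ≤ Y n e t k → 3 * Y n e t k ≤ Y n e t (k+1) := by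
    intro k h
    simp only [Y]
    nlinarith
  induction k with
  | zero => exact ⟨le_rfl, by simp [Y], key 0 le_rfl⟩
  | succ k ih =>
    have h1 : e t ≤ Y n e t (k+1) := by linarith [ih.1, ih.2.2]
    refine ⟨h1, ?_, key _ h1⟩
    rw [pow_succ]; linarith [ih.2.1, ih.2.2]

lemma Y_mono (n : ℕ) (e : ℝ → ℝ) (t : ℝ) (he : 0 ≤ e t) (ht : 4 < t^n) {k m : ℕ} (h : k ≤ m) :
    Y n e t k ≤ Y n e t m := by
  induction m, h using Nat.le_induction with
  | base => exact le_rfl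
  | succ m hm ih =>
    have := Y_grow n e t he ht m
    linarith

lemma weak_sg {a : ℝ} {n M : ℕ} {τ d : ℝ} (hw : Weak a n M τ d) : sg a (a/2) (n-1) = -τ := by
  have h14 := sqrt2_lb hw.ha
  have hd := hw.hd
  have hpow : 0 < a^n := by positivity
  have habs : |τ * (d / a^n)| = d / a^n := by
    rcases hw.hτ with h | h <;> rw [h] <;> simp [abs_of_pos (div_pos hd hpow)]
    all_goals rw [abs_of_pos hd, abs_of_pos (by linarith)]
  have hx : a^n * |τ * (d / a^n)| = d := by rw [habs]; field_simp
  have hf := fold (by linarith : 0 ≤ a) n hw.hn (τ * (d / a^n)) (by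
    intro l h0 hl
    have h1 := near hw.ha hl (τ * (d / a^n))
    rw [hx] at h1
    exact same_side h1 (by linarith [hw.w2 l h0 hl]))
  rw [hw.w6, hw.per, mul_assoc, hx] at hf
  have : (τ + sg a (a/2) (n-1)) * d = 0 := by linarith
  rcases mul_eq_zero.1 this with h | h
  · linarith
  · linarith

lemma local_fold {t : ℝ} (ht : Real.sqrt 2 < t) {n : ℕ} (hn : 0 < n) {τ d : ℝ} (hd : 0 < d)
    (hsep : ∀ l, 0 < l → l < n → 0.98 * d ≤ |xi t l - 1/2|)
    (hsg : sg t (t/2) (n-1) = -τ) (x : ℝ) (hx : t^n * |x| ≤ 1.2 * d) :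
    (tent t)^[n] (1/2 + x) = xi t n + τ * (t^n * |x|) := by
  have h14 := sqrt2_lb ht
  have hf := fold (by linarith : 0 ≤ t) n hn x (by
    intro l h0 hl
    have h1 := near ht hl x
    exact same_side h1 (by linarith [hsep l h0 hl]))
  rw [hf, hsg]; ring

lemma escape {t : ℝ} {n : ℕ} {τ d : ℝ} (hτ : τ = 1 ∨ τ = -1)
    (hloc : ∀ x, t^n * |x| ≤ 1.2 * d → (tent t)^[n] (1/2 + x) = xi t n + τ * (t^n * |x|))
    (e : ℝ → ℝ) (he : 0 ≤ e t) (hE : xi t n = 1/2 - τ * e t) (h4 : 4 < t^n) (K : ℕ)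
    (hK : ∀ k < K, t^n * Y n e t k ≤ 1.1 * d) (hd : 0 < d) :
    ∀ k ≤ K, |xi t ((k+1)*n) - 1/2| = Y n e t k ∧ (1 ≤ k → xi t ((k+1)*n) = 1/2 + τ * Y n e t k) := by
  intro k
  induction k with
  | zero =>
    intro _
    refine ⟨?_, by omega⟩
    simp only [zero_add, one_mul, Y]
    rw [hE]
    rcases hτ with h | h <;> rw [h] <;> simp [abs_of_nonneg he]
  | succ k ih =>
    intro hk
    obtain ⟨ih1, -⟩ := ih (by omega)
    have hx := hK k (by omega)
    have e1 : xi t ((k+1+1)*n) = 1/2 + τ * Y n e t (k+1) := by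
      have : (k+1+1)*n = n + (k+1)*n := by ring
      rw [this, xi_add]
      have h2 := hloc (xi t ((k+1)*n) - 1/2) (by rw [ih1]; linarith)
      rw [add_sub_cancel, ih1] at h2
      rw [h2, hE]; simp only [Y]; ring
    refine ⟨?_, fun _ => e1⟩
    rw [e1, add_sub_cancel_left]
    have := (Y_grow n e t he h4 (k+1)).1
    rcases hτ with h | h <;> rw [h] <;> simp [abs_of_nonneg (he.trans this)]

lemma strong_of {b : ℝ} (hb : Real.sqrt 2 < b) (hb2 : b < 2) {n n' : ℕ} (hn : 0 < n) (hnn : n < n')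
    {τ τ' d E : ℝ} (hτ : τ = 1 ∨ τ = -1) (hτ' : τ' = 1 ∨ τ' = -1) (hE : 0 < E) (hEd : E ≤ d/50)
    (hper : xi b n' = 1/2) (hlow : ∀ i, 0 < i → i < n' → E ≤ |xi b i - 1/2|)
    (hsep : ∀ l, 0 < l → l < n → 0.98 * d ≤ |xi b l - 1/2|)
    (hxn : xi b n = 1/2 - τ * E)
    (hloc : ∀ x, b^n * |x| ≤ 1.2 * d → (tent b)^[n] (1/2 + x) = xi b n + τ * (b^n * |x|))
    (hsg : sg b (b/2) (n'-1) = -τ') (h4 : 4 < b^n)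
    (hw5 : ∀ ε > 0, ∃ t, |t - b| < ε ∧ τ' * (xi t n' - 1/2) < 0) :
    Strong b n' τ' (2 * E / b^n) (2 * E) := by
  have h14 := sqrt2_lb hb
  have hb0 : 0 ≤ b := by linarith
  set d' := 2 * E / b^n with hd'
  have hbd : b^n * d' = 2 * E := by rw [hd']; field_simp
  have hd0 : 0 < d' := by rw [hd']; positivity
  have hdE : 2 * d' ≤ E := by nlinarith
  have habs : |τ' * d'| = d' := by
    rcases hτ' with h | h <;> rw [h] <;> simp [abs_of_pos hd0]
  have hun : (tent b)^[n] (1/2 + τ' * d') = 1/2 + τ * E := by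
    rw [hloc _ (by rw [habs, hbd]; linarith), habs, hbd, hxn]; ring
  have hun' : ∀ i, 0 < i → (tent b)^[n + i] (1/2 + τ' * d') = xi b (n + i) := by
    intro i hi
    obtain ⟨j, rfl⟩ : ∃ j, i = j + 1 := ⟨i - 1, by omega⟩
    rw [show n + (j+1) = (j+1) + n by ring, Function.iterate_add_apply, hun, xi_add, hxn,
      Function.iterate_succ_apply, Function.iterate_succ_apply, tent_symm hb0]
  have hlt : ∀ l < n, |(tent b)^[l] (1/2 + τ' * d') - xi b l| ≤ 0.7072 * (2 * E) := by
    intro l hl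
    have := near hb hl (τ' * d')
    rwa [habs, hbd] at this
  have hEabs : |τ * E| = E := by
    rcases hτ with h | h <;> rw [h] <;> simp [abs_of_pos hE]
  have s2 : ∀ l, 0 < l → l < n' → 2 * d' ≤ |(tent b)^[l] (1/2 + τ' * d') - 1/2| := by
    intro l h0 hl
    rcases lt_trichotomy l n with h | h | h
    · have h1 := hlt l h
      have h2 := hsep l h0 h
      have h3 := abs_sub_le (xi b l) ((tent b)^[l] (1/2 + τ' * d')) (1/2)
      rw [abs_sub_comm (xi b l) ((tent b)^[l] (1/2 + τ' * d'))] at h3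
      linarith
    · rw [h, hun, add_sub_cancel_left, hEabs]; exact hdE
    · obtain ⟨i, rfl⟩ : ∃ i, l = n + i := ⟨l - n, by omega⟩
      rw [hun' i (by omega)]
      exact hdE.trans (hlow _ h0 hl)
  have s1 : ∀ l, 0 < l → l < n' → 2 * d' ≤ |xi b l - 1/2| :=
    fun l h0 hl => hdE.trans (hlow l h0 hl)
  refine ⟨⟨hb, hb2, by omega, by omega, hτ', hd0, hper, ?_, ?_, ?_, hw5, ?_, ?_⟩, s1, s2, ?_⟩
  · intro l h0 hl; linarith [s1 l h0 hl]
  · obtain ⟨i, rfl⟩ : ∃ i, n' = n + i := ⟨n' - n, by omega⟩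
    rw [hun' i (by omega), hper]
  · intro l hl h
    rcases Nat.eq_zero_or_pos l with h0 | h0
    · rw [h0] at h
      simp only [Function.iterate_zero, id] at h
      have : τ' * d' = 0 := by linarith
      rw [this] at habs
      simp at habs; linarith
    · have := s2 l h0 hl
      rw [h] at this; simp at this; linarith
  · have hp : 0 < b^n' := by positivity
    have hab : b^n' * |τ' * (d' / b^n')| = d' := by
      rw [← mul_div_assoc, abs_div, habs, abs_of_pos hp]; field_simp
    have hf := fold hb0 n' (by omega) (τ' * (d' / b^n')) (by
      intro l h0 hl
      have h1 := iter_lip hb0 l (1/2 + τ' * (d' / b^n')) (1/2)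
      rw [add_sub_cancel_left] at h1
      have h2 : b^l * |τ' * (d' / b^n')| ≤ b^n' * |τ' * (d' / b^n')| :=
        mul_le_mul_of_nonneg_right (pow_le_pow_right₀ (by linarith) hl.le) (abs_nonneg _)
      rw [hab] at h2
      exact same_side (h1.trans h2) (by linarith [s1 l h0 hl]))
    rw [hf, hper, hsg, mul_assoc, hab]; ring
  · exact h4.trans_le (pow_le_pow_right₀ (by linarith) hnn.le)
  · intro l hl
    rcases lt_trichotomy l n with h | h | h
    · linarith [hlt l h]
    · rw [h, hun, hxn]
      have : 1/2 + τ * E - (1/2 - τ * E) = 2 * (τ * E) := by ring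
      rw [this, abs_mul, hEabs]; simp
    · obtain ⟨i, rfl⟩ : ∃ i, l = n + i := ⟨l - n, by omega⟩
      rw [hun' i (by omega)]; simp; linarith

set_option maxHeartbeats 2000000 in
lemma core {a : ℝ} {n M : ℕ} {τ d : ℝ} (hw : Weak a n M τ d) (κ : ℝ) (hκ : 0 < κ) :
    ∃ (a' : ℝ) (J : ℕ) (τ' d' η' : ℝ), |a' - a| < κ ∧ η' < κ ∧ 1 ≤ J ∧
      Strong a' (J * n + M) τ' d' η' ∧
      (∀ j < J, ∀ l < n, |xi a' (j * n + l) - xi a l| ≤ 0.8 * d) ∧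
      (∀ l ≤ M, |xi a' (J * n + l) - (tent a)^[l] (1/2 + τ * d)| < κ) := by
  have h14 := sqrt2_lb hw.ha
  have hd := hw.hd
  have hn := hw.hn
  have hM := hw.hM
  have hτ := hw.hτ
  have hττ : τ * τ = 1 := by rcases hτ with h | h <;> rw [h] <;> norm_num
  have hτabs : |τ| = 1 := by rcases hτ with h | h <;> rw [h] <;> norm_num
  set u := 1/2 + τ * d with hu
  -- constants
  obtain ⟨m, hm, hmu⟩ := exists_pos_lb (fun l => |(tent a)^[l] u - 1/2|) M
    (fun l hl => abs_pos.2 (sub_ne_zero.2 (hw.w4 l hl)))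
  set m1 := m / 2 with hm1
  have hm1' : 0 < m1 := by positivity
  have hmu' : ∀ l < M, 2 * m1 ≤ |(tent a)^[l] u - 1/2| := fun l hl => by
    have := hmu l hl
    linarith
  set κ1 := min κ m1 with hκ1
  have hκ1' : 0 < κ1 := lt_min hκ hm1'
  obtain ⟨δ1, hδ1, hj1⟩ := joint a u κ1 hκ1' M
  set ρ := min (δ1/2) (d/20) with hρ
  have hρ' : 0 < ρ := lt_min (by linarith) (by linarith)
  have hρ1 : ρ < δ1 := (min_le_left _ _).trans_lt (by linarith)
  have hρd : ρ ≤ d/20 := min_le_right _ _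
  set κ2 := min (d/50) (min m1 (κ/4)) with hκ2
  have hκ2' : 0 < κ2 := lt_min (by linarith) (lt_min hm1' (by linarith))
  have hκ2d : κ2 ≤ d/50 := min_le_left _ _
  have hκ2m : κ2 ≤ m1 := (min_le_right _ _).trans (min_le_left _ _)
  have hκ2κ : κ2 ≤ κ/4 := (min_le_right _ _).trans (min_le_right _ _)
  obtain ⟨δ2, hδ2, hj2⟩ := joint a (1/2) κ2 hκ2' n
  obtain ⟨δ3, hδ3, hj3⟩ := joint a u ρ hρ' M
  obtain ⟨δ4, hδ4, hj4⟩ : ∃ δ > 0, ∀ t, |t - a| < δ → 4 < t^n := by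
    have hc : ContinuousAt (fun t : ℝ => t^n) a := by fun_prop
    have := hc.eventually (lt_mem_nhds hw.w7)
    obtain ⟨δ, hδ, h⟩ := Metric.eventually_nhds_iff.1 this
    exact ⟨δ, hδ, fun t ht => h ht⟩
  obtain ⟨δ, hδ, hδall⟩ : ∃ δ > 0, δ ≤ δ1 ∧ δ ≤ δ2 ∧ δ ≤ δ3 ∧ δ ≤ δ4 ∧ δ ≤ κ ∧
      δ ≤ a - Real.sqrt 2 ∧ δ ≤ 2 - a := by
    refine ⟨min δ1 (min δ2 (min δ3 (min δ4 (min κ (min (a - Real.sqrt 2) (2 - a)))))), ?_, ?_⟩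
    · have := hw.ha; have := hw.ha2
      simp only [lt_min_iff, gt_iff_lt]
      refine ⟨hδ1, hδ2, hδ3, hδ4, hκ, ?_, ?_⟩ <;> linarith
    · simp [min_le_iff]
  obtain ⟨g1, g2, g3, g4, g5, g6, g7⟩ := hδall
  -- facts for t near a
  have f1 : ∀ t, |t - a| < δ → Real.sqrt 2 < t := fun t ht => by
    linarith [(abs_lt.1 ht).1]
  have f2 : ∀ t, |t - a| < δ → t < 2 := fun t ht => by linarith [(abs_lt.1 ht).2]
  have f4 : ∀ t, |t - a| < δ → 4 < t^n := fun t ht => hj4 t (ht.trans_le g4)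
  have fx : ∀ t, |t - a| < δ → ∀ l ≤ n, |xi t l - xi a l| < κ2 := fun t ht l hl =>
    hj2 t (1/2) (ht.trans_le g2) (by simpa using hδ2) l hl
  have fu : ∀ t, |t - a| < δ → |(tent t)^[M] u - 1/2| < ρ := fun t ht => by
    have := hj3 t u (ht.trans_le g3) (by simpa using hδ3) M le_rfl
    rwa [hw.w3] at this
  have fsep : ∀ t, |t - a| < δ → ∀ l, 0 < l → l < n → 0.98 * d ≤ |xi t l - 1/2| := by
    intro t ht l h0 hl
    have e1 := fx t ht l hl.le
    have e2 := hw.w2 l h0 hl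
    have e3 := abs_sub_le (xi a l) (xi t l) (1/2)
    rw [abs_sub_comm (xi a l) (xi t l)] at e3
    linarith
  have fsg : ∀ t, |t - a| < δ → sg t (t/2) (n-1) = -τ := by
    intro t ht
    rw [← weak_sg hw]
    have := sqrt2_lb (f1 t ht)
    apply sg_congr_xi (by linarith) (by linarith)
    intro l h0 hl
    exact same_side (fx t ht l hl.le).le (by linarith [hw.w2 l h0 hl])
  have floc : ∀ t, |t - a| < δ → ∀ x, t^n * |x| ≤ 1.2 * d →
      (tent t)^[n] (1/2 + x) = xi t n + τ * (t^n * |x|) := fun t ht x hx =>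
    local_fold (f1 t ht) hn hd (fsep t ht) (fsg t ht) x hx
  set e : ℝ → ℝ := fun t => max (-τ * (xi t n - 1/2)) 0 with he
  have hecont : Continuous e := by
    have := xi_cont n
    rw [he]; fun_prop
  have he0 : ∀ t, 0 ≤ e t := fun t => le_max_right _ _
  have heκ : ∀ t, |t - a| < δ → e t < κ2 := by
    intro t ht
    have := fx t ht n le_rfl
    rw [hw.per] at this
    refine max_lt (lt_of_le_of_lt (le_abs_self _) ?_) hκ2'
    rw [abs_mul, abs_neg, hτabs, one_mul]; exact this
  have hexi : ∀ t, 0 < e t → xi t n = 1/2 - τ * e t := by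
    intro t ht
    have h1 : e t = -τ * (xi t n - 1/2) := by
      simp only [he] at ht ⊢
      rcases max_cases (-τ * (xi t n - 1/2)) 0 with h | h
      · exact h.1
      · rw [h.1] at ht; exact absurd ht (lt_irrefl _)
    rw [h1]
    linear_combination (1/2 - xi t n) * hττ
  have hea : e a = 0 := by simp [he, hw.per]
  -- choose t*
  obtain ⟨ts, hts1, hts2⟩ := hw.w5 δ hδ
  have hets : 0 < e ts := by
    simp only [he]
    exact lt_max_of_lt_left (by linarith)
  obtain ⟨K0, hK0⟩ := pow_unbounded_of_one_lt ((d+ρ)/e ts) (by norm_num : (1:ℝ) < 3)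
  set K := K0 + 1 with hK
  have hKts : d + ρ ≤ Y n e ts K := by
    have h1 := (Y_grow n e ts hets.le (f4 ts hts1) K).2.1
    have h2 : d + ρ < 3^K0 * e ts := by rwa [div_lt_iff₀ hets] at hK0
    have h3 : (3:ℝ)^K = 3 * 3^K0 := by rw [hK, pow_succ]; ring
    rw [h3] at h1
    have : 0 < (3:ℝ)^K0 * e ts := by positivity
    linarith
  obtain ⟨p, q, hpq, hgp, hgq, hgt⟩ := subseg (fun t => Y n e t K) (Y_cont n e hecont K) a ts
    (d - ρ) (d + ρ) (by linarith) (by simp only [Y_zero n e a hea]; linarith) hKts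
  -- facts on the segment
  have sδ : ∀ t ∈ Set.uIcc p q, |t - a| < δ := by
    intro t ht
    have h1 := hpq ht
    exact (Set.abs_sub_left_of_mem_uIcc h1).trans_lt hts1
  have sE : ∀ t ∈ Set.uIcc p q, 0 < e t := by
    intro t ht
    rcases (he0 t).lt_or_eq with h | h
    · exact h
    · have := (hgt t ht).1
      rw [Y_zero n e t h.symm] at this
      linarith
  have sY : ∀ t ∈ Set.uIcc p q, ∀ k < K, t^n * Y n e t k ≤ 1.1 * d := by
    intro t ht k hk
    have h1 := Y_mono n e t (he0 t) (f4 t (sδ t ht)) (show k + 1 ≤ K by omega)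
    have h2 := (hgt t ht).2
    have h3 := heκ t (sδ t ht)
    simp only [Y] at h1
    linarith
  have sesc : ∀ t ∈ Set.uIcc p q, ∀ k ≤ K, |xi t ((k+1)*n) - 1/2| = Y n e t k ∧
      (1 ≤ k → xi t ((k+1)*n) = 1/2 + τ * Y n e t k) := fun t ht =>
    escape hτ (floc t (sδ t ht)) e (he0 t) (hexi t (sE t ht)) (f4 t (sδ t ht)) K (sY t ht) hd
  set J := K + 1 with hJ
  have sA : ∀ t ∈ Set.uIcc p q, ∀ j < J, ∀ l < n, |xi t (j*n+l) - xi t l| ≤ 0.7072 * (1.1 * d) := by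
    intro t ht j hj l hl
    rcases Nat.eq_zero_or_pos j with h0 | h0
    · rw [h0]; simp; linarith
    · obtain ⟨k, rfl⟩ : ∃ k, j = k + 1 := ⟨j - 1, by omega⟩
      have h1 := near (f1 t (sδ t ht)) hl (xi t ((k+1)*n) - 1/2)
      rw [(sesc t ht k (by omega)).1, add_sub_cancel, ← xi_add] at h1
      rw [add_comm]
      have := sY t ht k (by omega)
      linarith
  have sz : ∀ t ∈ Set.uIcc p q, xi t (J*n) = 1/2 + τ * Y n e t K := fun t ht =>
    (sesc t ht K le_rfl).2 (by omega)
  have szu : ∀ t ∈ Set.uIcc p q, xi t (J*n) - u = τ * (Y n e t K - d) := fun t ht => by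
    rw [sz t ht, hu]; ring
  have sB : ∀ t ∈ Set.uIcc p q, ∀ l ≤ M, |xi t (J*n+l) - (tent a)^[l] u| < κ1 := by
    intro t ht l hl
    rw [add_comm, xi_add]
    refine hj1 t _ ((sδ t ht).trans_le g1) ?_ l hl
    rw [szu t ht, abs_mul, hτabs, one_mul]
    refine lt_of_le_of_lt ?_ hρ1
    rw [abs_le]
    constructor <;> linarith [(hgt t ht).1, (hgt t ht).2]
  have slow : ∀ t ∈ Set.uIcc p q, ∀ i, 0 < i → i < J*n+M → e t ≤ |xi t i - 1/2| := by
    intro t ht i h0 hi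
    have hek := heκ t (sδ t ht)
    rcases lt_or_ge i (J*n) with h | h
    · have hl := Nat.mod_lt i hn
      have hj : i / n < J := Nat.div_lt_of_lt_mul (by rwa [mul_comm])
      have hdm : i / n * n + i % n = i := Nat.div_add_mod' i n
      rcases Nat.eq_zero_or_pos (i % n) with hz | hz
      · rw [hz, add_zero] at hdm
        have hj0 : 0 < i / n := by
          rcases Nat.eq_zero_or_pos (i / n) with h' | h'
          · rw [h'] at hdm; omega
          · exact h'
        obtain ⟨k, hk⟩ : ∃ k, i / n = k + 1 := ⟨i / n - 1, by omega⟩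
        rw [← hdm, hk, (sesc t ht k (by omega)).1]
        exact (Y_grow n e t (he0 t) (f4 t (sδ t ht)) k).1
      · have h1 := sA t ht _ hj _ hl
        rw [hdm] at h1
        have h2 := fsep t (sδ t ht) _ hz hl
        have h3 := abs_sub_le (xi t (i % n)) (xi t i) (1/2)
        rw [abs_sub_comm (xi t (i % n)) (xi t i)] at h3
        linarith
    · obtain ⟨l, rfl⟩ : ∃ l, i = J*n + l := ⟨i - J*n, by omega⟩
      have h1 := sB t ht l (by omega)
      have h2 := hmu' l (by omega)
      have h3 := abs_sub_le ((tent a)^[l] u) (xi t (J*n+l)) (1/2)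
      rw [abs_sub_comm ((tent a)^[l] u) (xi t (J*n+l))] at h3
      have h4 : κ1 ≤ m1 := min_le_right _ _
      linarith
  -- transversal crossing
  have hcross : ∀ t ∈ Set.uIcc p q, xi t (J*n+M) - (tent t)^[M] u
      = sg a u M * t^M * (τ * (Y n e t K - d)) := by
    intro t ht
    have h14t := sqrt2_lb (f1 t (sδ t ht))
    have hut : ∀ i < M, |(tent t)^[i] u - (tent a)^[i] u| < κ1 := fun i hi =>
      hj1 t u ((sδ t ht).trans_le g1) (by simpa using hδ1) i hi.le
    have h4 : κ1 ≤ m1 := min_le_right _ _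
    have h1 : sg t u M = sg a u M := sg_congr fun i hi =>
      same_side (hut i hi).le (by linarith [hmu' i hi])
    have h2 := affine (by linarith : 0 ≤ t) M (xi t (J*n)) u (by
      intro i hi
      have e1 := same_side (hut i hi).le (by linarith [hmu' i hi])
      have e2 := sB t ht i hi.le
      rw [add_comm, xi_add] at e2
      have e3 := same_side e2.le (by linarith [hmu' i hi])
      have := mul_pos e1 e3
      by_contra hc
      push Not at hc
      nlinarith [sq_nonneg ((tent a)^[i] u - 1/2)])
    rw [← xi_add, szu t ht, h1, add_comm M] at h2
    exact h2
  have hpm : p ∈ Set.uIcc p q := Set.left_mem_uIcc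
  have hqm : q ∈ Set.uIcc p q := Set.right_mem_uIcc
  have hopp : (xi p (J*n+M) - 1/2) * (xi q (J*n+M) - 1/2) < 0 := by
    have cp := hcross p hpm
    have cq := hcross q hqm
    rw [hgp] at cp
    rw [hgq] at cq
    have up := abs_lt.1 (fu p (sδ p hpm))
    have uq := abs_lt.1 (fu q (sδ q hqm))
    have pp : 1 ≤ p^M := one_le_pow₀ (by linarith [sqrt2_lb (f1 p (sδ p hpm))])
    have pq : 1 ≤ q^M := one_le_pow₀ (by linarith [sqrt2_lb (f1 q (sδ q hqm))])
    have pp' : ρ ≤ p^M * ρ := by nlinarith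
    have pq' : ρ ≤ q^M * ρ := by nlinarith
    have hω : sg a u M * τ = 1 ∨ sg a u M * τ = -1 := by
      rcases sg_cases a u M with h | h <;> rcases hτ with h' | h' <;> rw [h, h'] <;> norm_num
    have cp' : xi p (J*n+M) - (tent p)^[M] u = -((sg a u M * τ) * (p^M * ρ)) := by
      rw [cp]; ring
    have cq' : xi q (J*n+M) - (tent q)^[M] u = (sg a u M * τ) * (q^M * ρ) := by
      rw [cq]; ring
    rcases hω with h | h <;> rw [h] at cp' cq'
    · exact mul_neg_of_neg_of_pos (by linarith) (by linarith)
    · exact mul_neg_of_pos_of_neg (by linarith) (by linarith)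
  set n' := J*n+M with hn'
  set τ' := -sg p (p/2) (n'-1) with hτ'
  have hτ'c : τ' = 1 ∨ τ' = -1 := by
    rcases sg_cases p (p/2) (n'-1) with h | h <;> rw [hτ', h] <;> norm_num
  have hτ'2 : τ' * τ' = 1 := by rcases hτ'c with h | h <;> rw [h] <;> norm_num
  obtain ⟨a', ha', hper, hfr⟩ := frontier_pt (fun t => -τ' * (xi t n' - 1/2))
    (by have := xi_cont n'; fun_prop) p q (by
      have : -τ' * (xi p n' - 1/2) * (-τ' * (xi q n' - 1/2)) =
        (τ' * τ') * ((xi p n' - 1/2) * (xi q n' - 1/2)) := by ring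
      rw [this, hτ'2, one_mul]; exact hopp)
  have hper' : xi a' n' = 1/2 := by
    rcases hτ'c with h | h <;> rw [h] at hper <;> linarith
  have hsg' : sg a' (a'/2) (n'-1) = -τ' := by
    rw [hτ', neg_neg]
    apply sg_congr_xi
    · linarith [sqrt2_lb (f1 a' (sδ a' ha'))]
    · linarith [sqrt2_lb (f1 p (sδ p hpm))]
    intro l h0 hl
    refine same_sign_seg (fun t => xi t l - 1/2) (by have := xi_cont l; fun_prop) p q ?_ ha' hpm
    intro t ht h
    have h1 := slow t ht l h0 hl
    have h2 := sE t ht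
    rw [h, abs_zero] at h1
    linarith
  have ha'δ := sδ a' ha'
  have hee := heκ a' ha'δ
  have hJn : n ≤ J * n := Nat.le_mul_of_pos_left n (by omega)
  refine ⟨a', J, τ', 2 * e a' / a'^n, 2 * e a', ha'δ.trans_le g5, by linarith, by omega, ?_, ?_, ?_⟩
  · refine strong_of (τ := τ) (d := d) (f1 a' ha'δ) (f2 a' ha'δ) hn (by omega) hτ hτ'c (sE a' ha') (by linarith)
      hper' (slow a' ha') (fsep a' ha'δ) (hexi a' (sE a' ha')) (floc a' ha'δ) hsg' (f4 a' ha'δ) ?_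
    intro ε hε
    obtain ⟨t, h1, h2⟩ := hfr ε hε
    exact ⟨t, h1, by linarith⟩
  · intro j hj l hl
    have h1 := sA a' ha' j hj l hl
    have h2 := fx a' ha'δ l hl.le
    have h3 := abs_sub_le (xi a' (j*n+l)) (xi a' l) (xi a l)
    linarith
  · intro l hl
    exact (sB a' ha' l hl).trans_le (min_le_left _ _)

lemma xi_mod {a : ℝ} {n : ℕ} (h : xi a n = 1/2) (i : ℕ) : xi a i = xi a (i % n) := by
  have hp : Function.IsPeriodicPt (tent a) n (1/2) := h
  have := hp.iterate_mod_apply i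
  exact this.symm

lemma step {a : ℝ} {n : ℕ} {τ d η : ℝ} (hs : Strong a n τ d η) (κ : ℝ) (hκ : 0 < κ) :
    ∃ (a' : ℝ) (n' : ℕ) (τ' d' η' : ℝ), Strong a' n' τ' d' η' ∧ |a' - a| < κ ∧ η' < κ ∧
      n < n' ∧ (∀ i, |xi a' i - xi a i| ≤ 2 * η) ∧
      (∀ i, n ∣ i → |xi a' i - 1/2| ≤ 1.05 * d) ∧
      (∀ i, ¬ n ∣ i → 1.2 * d ≤ |xi a' i - 1/2|) := by
  have hw := hs.weak
  have hd := hw.hd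
  have hn := hw.hn
  have hdη : d ≤ η := by
    have := hs.s3 0 (Nat.zero_le _)
    simp only [Function.iterate_zero, id, xi_zero] at this
    rw [show (1:ℝ)/2 + τ * d - 1/2 = τ * d by ring, abs_mul, abs_of_pos hd] at this
    rcases hw.hτ with h | h <;> rw [h] at this <;> simpa using this
  obtain ⟨a', J, τ', d', η', h1, h2, h3, h4, hA, hB⟩ := core hw (min κ (d/20)) (lt_min hκ (by linarith))
  have hκ' : min κ (d/20) ≤ d/20 := min_le_right _ _
  have hper := h4.weak.per
  have hn' : n < J * n + n := by nlinarith
  -- reduction to i < n'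
  have red : ∀ i, ∃ i' < J * n + n, xi a' i = xi a' i' ∧ xi a i = xi a i' ∧ (n ∣ i ↔ n ∣ i') := by
    intro i
    refine ⟨i % (J*n+n), Nat.mod_lt _ (by omega), xi_mod hper i, ?_, ?_⟩
    · rw [xi_mod hw.per i, xi_mod hw.per (i % (J*n+n)), Nat.mod_mod_of_dvd]
      exact ⟨J+1, by ring⟩
    · rw [Nat.dvd_mod_iff]
      exact ⟨J+1, by ring⟩
  have dec : ∀ i < J * n + n, ∃ j l, i = j * n + l ∧ l < n ∧ j ≤ J := by
    intro i hi
    refine ⟨i / n, i % n, ?_, Nat.mod_lt _ hn, ?_⟩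
    · rw [mul_comm]; exact (Nat.div_add_mod i n).symm
    · have : i / n < J + 1 := by rw [Nat.div_lt_iff_lt_mul hn]; linarith
      omega
  have xj : ∀ j l, l < n → xi a (j * n + l) = xi a l := by
    intro j l hl
    rw [xi_mod hw.per]
    rw [Nat.mul_add_mod_of_lt hl]
  refine ⟨a', J*n+n, τ', d', η', h4, lt_of_lt_of_le h1 (min_le_left _ _),
    lt_of_lt_of_le h2 (min_le_left _ _), hn', ?_, ?_, ?_⟩
  · intro i
    obtain ⟨i', hi', e1, e2, -⟩ := red i
    rw [e1, e2]
    obtain ⟨j, l, rfl, hl, hj⟩ := dec i' hi'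
    rw [xj j l hl]
    rcases hj.lt_or_eq with hj | rfl
    · have := hA j hj l hl
      linarith
    · have := hB l hl.le
      have h5 := hs.s3 l hl.le
      have := abs_sub_le (xi a' (j*n+l)) ((tent a)^[l] (1/2 + τ * d)) (xi a l)
      linarith
  · intro i hi
    obtain ⟨i', hi', e1, e2, e3⟩ := red i
    rw [e1]
    rw [e3] at hi
    obtain ⟨j, l, rfl, hl, hj⟩ := dec i' hi'
    have hl0 : l = 0 := by
      rw [Nat.dvd_add_right (Dvd.intro_left j rfl)] at hi
      exact Nat.eq_zero_of_dvd_of_lt hi hl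
    subst hl0
    rcases hj.lt_or_eq with hj | rfl
    · have := hA j hj 0 hl
      rw [xi_zero] at this
      linarith
    · have := hB 0 hl.le
      simp only [Function.iterate_zero, id] at this
      have h6 := abs_sub_le (xi a' (j*n+0)) (1/2 + τ * d) (1/2)
      have h7 : |1/2 + τ * d - 1/2| ≤ d := by
        rw [show (1:ℝ)/2 + τ * d - 1/2 = τ * d by ring, abs_mul, abs_of_pos hd]
        rcases hw.hτ with h | h <;> rw [h] <;> simp
      linarith
  · intro i hi
    obtain ⟨i', hi', e1, e2, e3⟩ := red i
    rw [e1]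
    rw [e3] at hi
    obtain ⟨j, l, rfl, hl, hj⟩ := dec i' hi'
    have hl0 : 0 < l := by
      rcases Nat.eq_zero_or_pos l with rfl | h
      · exact absurd (Dvd.intro_left j rfl) hi
      · exact h
    rcases hj.lt_or_eq with hj | rfl
    · have := hA j hj l hl
      have h5 := hs.s1 l hl0 hl
      have h6 := abs_sub_le (xi a l) (xi a' (j*n+l)) (1/2)
      rw [abs_sub_comm (xi a l) (xi a' (j*n+l))] at h6
      linarith
    · have := hB l hl.le
      have h5 := hs.s2 l hl0 hl
      have h6 := abs_sub_le ((tent a)^[l] (1/2 + τ * d)) (xi a' (j*n+l)) (1/2)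
      rw [abs_sub_comm ((tent a)^[l] (1/2 + τ * d)) (xi a' (j*n+l))] at h6
      linarith

structure St where
  a : ℝ
  n : ℕ
  τ : ℝ
  d : ℝ
  η : ℝ
  κ : ℝ

lemma seq_exists {α : Type*} (P : ℕ → α → Prop) (R : ℕ → α → α → Prop) (s0 : α) (h0 : P 0 s0)
    (hs : ∀ k s, P k s → ∃ s', P (k+1) s' ∧ R k s s') :
    ∃ f : ℕ → α, (∀ k, P k (f k)) ∧ ∀ k, R k (f k) (f (k+1)) := by
  choose g hg using hs
  let F : (k : ℕ) → {s // P k s} := fun k =>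
    Nat.rec ⟨s0, h0⟩ (fun k s => ⟨g k s.1 s.2, (hg k s.1 s.2).1⟩) k
  exact ⟨fun k => (F k).1, fun k => (F k).2, fun k => (hg k (F k).1 (F k).2).2⟩

lemma geo (f κ : ℕ → ℝ) (C : ℝ) (hC : 0 ≤ C) (hκ0 : ∀ k, 0 < κ k) (hκ : ∀ k, κ (k+1) ≤ κ k / 2)
    (hf : ∀ k, |f (k+1) - f k| ≤ C * κ k) (k m : ℕ) (hkm : k ≤ m) :
    |f m - f k| ≤ 2 * C * κ k := by
  have : |f m - f k| ≤ 2 * C * (κ k - κ m) := by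
    induction m, hkm using Nat.le_induction with
    | base => simp
    | succ m hm ih =>
      have h1 := abs_sub_le (f (m+1)) (f m) (f k)
      have h2 := hf m
      have h3 := hκ m
      nlinarith
  nlinarith [mul_nonneg hC (hκ0 m).le]

lemma uncountable_piece (x y : ℝ) (hx : Real.sqrt 2 ≤ x) (hy : y ≤ 2)
    (a0 : ℝ) (n0 : ℕ) (τ0 d0 η0 : ℝ) (h0 : Strong a0 n0 τ0 d0 η0) (ha0 : a0 ∈ Set.Ioo x y)
    (b : ℕ → ℝ) : ∃ a ∈ Set.Ioo x y, Good a ∧ ∀ k, a ≠ b k := by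
  let P : ℕ → St → Prop := fun k s => Strong s.a s.n s.τ s.d s.η ∧ 0 < s.κ ∧ s.κ ≤ s.d/200 ∧
    (k ≠ 0 → 2 * s.κ < |s.a - b (k-1)|) ∧ (2 * s.κ < s.a - x) ∧ (2 * s.κ < y - s.a) ∧ k ≤ s.n
  let R : ℕ → St → St → Prop := fun k s s' => |s'.a - s.a| < s.κ ∧ s'.η < s.κ ∧ s'.κ ≤ s.κ/2 ∧
      (∀ i, |xi s'.a i - xi s.a i| ≤ 2 * s.η) ∧
      (∀ i, s.n ∣ i → |xi s'.a i - 1/2| ≤ 1.05 * s.d) ∧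
      (∀ i, ¬ s.n ∣ i → 1.2 * s.d ≤ |xi s'.a i - 1/2|)
  have hd0 := h0.weak.hd
  obtain ⟨f, hP, hR⟩ := seq_exists P R
    ⟨a0, n0, τ0, d0, η0, min (d0/200) (min ((a0-x)/3) ((y-a0)/3))⟩ (by
      have m1 := min_le_left (d0/200) (min ((a0-x)/3) ((y-a0)/3))
      have m2 := min_le_right (d0/200) (min ((a0-x)/3) ((y-a0)/3))
      have m3 := min_le_left ((a0-x)/3) ((y-a0)/3)
      have m4 := min_le_right ((a0-x)/3) ((y-a0)/3)
      have k1 := ha0.1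
      have k2 := ha0.2
      refine ⟨h0, lt_min (by linarith) (lt_min (by linarith) (by linarith)), m1, by simp, ?_, ?_, Nat.zero_le _⟩
      · (try simp only); linarith
      · (try simp only); linarith) (by
    rintro k ⟨a, n, τ, d, η, κ⟩ ⟨hs, hκ, hκd, -, hax, hay, hkn⟩
    simp only at hs hκ hκd hax hay hkn
    -- avoid b k
    obtain ⟨κ1, hκ1, hκ1κ, hκ1b⟩ : ∃ κ1 > 0, κ1 ≤ κ ∧ (a ≠ b k → κ1 ≤ |a - b k|) := by
      by_cases h : a = b k
      · exact ⟨κ, hκ, le_rfl, fun h' => absurd h h'⟩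
      · exact ⟨min κ |a - b k|, lt_min hκ (abs_pos.2 (sub_ne_zero.2 h)), min_le_left _ _,
          fun _ => min_le_right _ _⟩
    obtain ⟨a', n', τ', d', η', hs', e1, e2, e3, e4, e5, e6⟩ := step hs κ1 hκ1
    have hne : a' ≠ a := by
      rintro rfl
      have := hs'.s1 n hs.weak.hn e3
      rw [hs.weak.per] at this
      simp at this
      linarith [hs'.weak.hd]
    have hneb : a' ≠ b k := by
      rintro h
      by_cases h' : a = b k
      · exact hne (h.trans h'.symm)
      · have := hκ1b h'
        rw [h, abs_sub_comm] at e1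
        linarith
    have hpos : 0 < |a' - b k| := abs_pos.2 (sub_ne_zero.2 hneb)
    have hd' := hs'.weak.hd
    have hab := abs_lt.1 e1
    obtain ⟨κ', q0, q1, q2, q3, q4, q5⟩ : ∃ κ' > 0, κ' ≤ d'/200 ∧ 2 * κ' < |a' - b k| ∧
        2 * κ' < a' - x ∧ 2 * κ' < y - a' ∧ κ' ≤ κ / 2 := by
      refine ⟨min (min (d'/200) (|a' - b k|/3)) (min (min ((a'-x)/3) ((y-a')/3)) (κ/2)), ?_, ?_, ?_, ?_, ?_, ?_⟩
      · apply lt_min (lt_min _ _) (lt_min (lt_min _ _) _) <;> linarith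
      · exact (min_le_left _ _).trans (min_le_left _ _)
      · have := (min_le_left (min (d'/200) (|a' - b k|/3)) (min (min ((a'-x)/3) ((y-a')/3)) (κ/2))).trans (min_le_right _ _)
        linarith
      · have := ((min_le_right (min (d'/200) (|a' - b k|/3)) (min (min ((a'-x)/3) ((y-a')/3)) (κ/2))).trans (min_le_left _ _)).trans (min_le_left _ _)
        linarith
      · have := ((min_le_right (min (d'/200) (|a' - b k|/3)) (min (min ((a'-x)/3) ((y-a')/3)) (κ/2))).trans (min_le_left _ _)).trans (min_le_right _ _)
        linarith
      · exact (min_le_right _ _).trans (min_le_right _ _)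
    refine ⟨⟨a', n', τ', d', η', κ'⟩, ⟨hs', q0, q1, fun _ => by simpa using q2, q3, q4, ?_⟩,
      ⟨by (try simp only); linarith, by (try simp only); linarith, q5, e4, e5, e6⟩⟩
    (try simp only); omega)
  have hκ0 : ∀ k, 0 < (f k).κ := fun k => (hP k).2.1
  have hκh : ∀ k, (f (k+1)).κ ≤ (f k).κ / 2 := fun k => (hR k).2.2.1
  have hκlim : ∀ ε > 0, ∃ k0, ∀ k ≥ k0, (f k).κ < ε := by
    intro ε hε
    have hb : ∀ k, (f k).κ ≤ (f 0).κ * (1/2)^k := by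
      intro k
      induction k with
      | zero => simp
      | succ k ih => have := hκh k; rw [pow_succ]; linarith
    have ht : Filter.Tendsto (fun k : ℕ => (f 0).κ * (1/2:ℝ)^k) Filter.atTop (nhds ((f 0).κ * 0)) :=
      (tendsto_pow_atTop_nhds_zero_of_lt_one (by norm_num) (by norm_num)).const_mul _
    rw [mul_zero] at ht
    obtain ⟨k0, hk0⟩ := Filter.eventually_atTop.1 (ht.eventually (gt_mem_nhds hε))
    exact ⟨k0, fun k hk => (hb k).trans_lt (hk0 k hk)⟩
  have hga : ∀ k m, k ≤ m → |(f m).a - (f k).a| ≤ 2 * (f k).κ := by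
    intro k m hkm
    have := geo (fun k => (f k).a) (fun k => (f k).κ) 1 (by norm_num) hκ0 hκh
      (fun k => by have := (hR k).1; (try simp only); linarith) k m hkm
    simpa using this
  have hgx : ∀ i k m, k ≤ m → |xi (f (m+1)).a i - xi (f (k+1)).a i| ≤ 4 * (f k).κ := by
    intro i k m hkm
    have := geo (fun k => xi (f (k+1)).a i) (fun k => (f k).κ) 2 (by norm_num) hκ0 hκh
      (fun k => by
        have h1 := (hR (k+1)).2.2.2.1 i
        have h2 := (hR k).2.1
        (try simp only); linarith) k m hkm
    linarith
  have hcau : CauchySeq fun k => (f k).a := by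
    rw [Metric.cauchySeq_iff']
    intro ε hε
    obtain ⟨k0, hk0⟩ := hκlim (ε/2) (by linarith)
    refine ⟨k0, fun m hm => ?_⟩
    rw [Real.dist_eq]
    have := hga k0 m hm
    have := hk0 k0 le_rfl
    linarith
  obtain ⟨a, hlim⟩ := cauchySeq_tendsto_of_complete hcau
  have hla : ∀ k, |a - (f k).a| ≤ 2 * (f k).κ := by
    intro k
    have : Filter.Tendsto (fun m => |(f m).a - (f k).a|) Filter.atTop (nhds |a - (f k).a|) :=
      (hlim.sub_const _).abs
    exact le_of_tendsto this (Filter.eventually_atTop.2 ⟨k, fun m hm => hga k m hm⟩)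
  have hlx : ∀ i k, |xi a i - xi (f (k+1)).a i| ≤ 4 * (f k).κ := by
    intro i k
    have h1 : Filter.Tendsto (fun m => xi (f (m+1)).a i) Filter.atTop (nhds (xi a i)) :=
      ((xi_cont i).tendsto a).comp (hlim.comp (Filter.tendsto_add_atTop_nat 1))
    have : Filter.Tendsto (fun m => |xi (f (m+1)).a i - xi (f (k+1)).a i|) Filter.atTop
      (nhds |xi a i - xi (f (k+1)).a i|) := (h1.sub_const _).abs
    exact le_of_tendsto this (Filter.eventually_atTop.2 ⟨k, fun m hm => hgx i k m hm⟩)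
  refine ⟨a, ?_, ?_, ?_⟩
  · have h1 := abs_le.1 (hla 0)
    have h2 := (hP 0).2.2.2.2.1
    have h3 := (hP 0).2.2.2.2.2.1
    constructor <;> linarith
  · intro N ε hε
    obtain ⟨k0, hk0⟩ := hκlim (ε/8) (by linarith)
    obtain ⟨k, hk, hkN⟩ : ∃ k, k0 ≤ k ∧ N ≤ k := ⟨max k0 N, le_max_left _ _, le_max_right _ _⟩
    have hkk := hk0 k hk
    have hst := (hP (k+1)).1
    refine ⟨(f (k+1)).n, 1.1 * (f (k+1)).d, 1.15 * (f (k+1)).d, ?_, ?_, ?_, ?_, ?_⟩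
    · have := (hP (k+1)).2.2.2.2.2.2
      omega
    · have := hst.weak.hd
      linarith
    · intro i hi
      have h1 := (hR (k+1)).2.2.2.2.1 i hi
      have h2 := hlx i (k+1)
      have h3 := (hP (k+1)).2.2.1
      have h4 := abs_sub_le (xi a i) (xi (f (k+1+1)).a i) (1/2)
      have := hst.weak.hd
      linarith
    · intro i hi
      have h1 := (hR (k+1)).2.2.2.2.2 i hi
      have h2 := hlx i (k+1)
      have h3 := (hP (k+1)).2.2.1
      have h4 := abs_sub_le (xi (f (k+1+1)).a i) (xi a i) (1/2)
      rw [abs_sub_comm (xi (f (k+1+1)).a i) (xi a i)] at h4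
      have := hst.weak.hd
      linarith
    · intro i j hij
      have h1 := hlx i k
      have h2 := hlx j k
      have h3 : xi (f (k+1)).a i = xi (f (k+1)).a j := by
        rw [xi_mod hst.weak.per i, xi_mod hst.weak.per j, hij]
      rw [← h3] at h2
      have h4 := abs_sub_le (xi a i) (xi (f (k+1)).a i) (xi a j)
      rw [abs_sub_comm (xi (f (k+1)).a i) (xi a j)] at h4
      linarith
  · rintro k rfl
    have h1 := hla (k+1)
    have h2 := (hP (k+1)).2.2.2.1 (by omega)
    simp only [Nat.add_sub_cancel] at h2
    rw [abs_sub_comm] at h1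
    linarith

lemma power_id (α : ℕ → ℝ) (hα : ∀ k, |α k| ≤ 1) {x y : ℝ} (hx : 0 < x) (hxy : x < y) (hy : y < 1)
    (h : ∀ z ∈ Set.Ioo x y, ∑' k, α k * z^k = 1/2) : α 0 = 1/2 := by
  set f : ℂ → ℂ := fun z => (∑' k, (α k : ℂ) * z^k) - 1/2 with hf
  have hd : DifferentiableOn ℂ f (Metric.ball 0 y) := by
    apply DifferentiableOn.sub_const
    apply Complex.differentiableOn_tsum_of_summable_norm (u := fun k => y^k)
    · exact summable_geometric_of_lt_one (by linarith) hy
    · intro i; fun_prop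
    · exact Metric.isOpen_ball
    · intro i w hw
      rw [norm_mul, norm_pow, Complex.norm_real, Real.norm_eq_abs]
      have h1 : ‖w‖ < y := by simpa using hw
      have h2 : ‖w‖^i ≤ y^i := pow_le_pow_left₀ (norm_nonneg _) h1.le i
      have h3 : 0 ≤ ‖w‖^i := by positivity
      nlinarith [hα i]
  have ha := hd.analyticOnNhd Metric.isOpen_ball
  set z0 := (x+y)/2 with hz0
  have hfr : ∃ᶠ z in nhdsWithin (z0 : ℂ) {(z0 : ℂ)}ᶜ, f z = 0 := by
    have ht : Filter.Tendsto (fun r : ℝ => (r : ℂ)) (nhdsWithin z0 {z0}ᶜ)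
        (nhdsWithin (z0 : ℂ) {(z0 : ℂ)}ᶜ) := by
      apply tendsto_nhdsWithin_of_tendsto_nhds_of_eventually_within
      · exact (Complex.continuous_ofReal.tendsto z0).mono_left nhdsWithin_le_nhds
      · filter_upwards [self_mem_nhdsWithin] with r hr
        have hr' : r ≠ z0 := hr
        have : (r : ℂ) ≠ z0 := by exact_mod_cast hr'
        exact this
    refine ht.frequently (Filter.Eventually.frequently ?_)
    have : Set.Ioo x y ∈ nhds z0 := Ioo_mem_nhds (by linarith) (by linarith)
    filter_upwards [nhdsWithin_le_nhds this] with r hr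
    have h1 := h r hr
    simp only [hf]
    have h2 : (∑' k, (α k : ℂ) * (r:ℂ)^k) = ((∑' k, α k * r^k : ℝ) : ℂ) := by
      rw [Complex.ofReal_tsum]; push_cast; rfl
    rw [h2, h1]; push_cast; ring
  have hz := ha.eqOn_zero_of_preconnected_of_frequently_eq_zero
    (convex_ball (0:ℂ) y).isPreconnected (z₀ := (z0 : ℂ)) (by
      simp only [Metric.mem_ball, dist_zero_right, Complex.norm_real, Real.norm_eq_abs]
      rw [abs_of_pos (by linarith)]; linarith) hfr
  have h0 := hz (show (0:ℂ) ∈ Metric.ball 0 y by simp; linarith)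
  simp only [hf, Pi.zero_apply] at h0
  have h5 : (∑' k, (α k : ℂ) * (0:ℂ)^k) = α 0 := by
    rw [tsum_eq_single 0]
    · simp
    · intro k hk; simp [hk]
  rw [h5] at h0
  have : (α 0 : ℂ) = ((1/2 : ℝ) : ℂ) := by push_cast; linear_combination h0
  exact_mod_cast this

lemma id_lemma {p q : ℝ} (hp : 1 < p) (hpq : p < q) (hq : q ≤ 2) :
    ∃ m, ∃ s ∈ Set.Ioo p q, ∃ t ∈ Set.Ioo p q, xi s m < 1/2 ∧ 1/2 < xi t m := by
  classical
  by_contra hc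
  push Not at hc
  set P : ℕ → Prop := fun m => ∃ s ∈ Set.Ioo p q, xi s m < 1/2 with hP
  set b : ℕ → ℝ := fun m => if P m then 0 else 1 with hb
  set ε : ℕ → ℝ := fun m => if P m then 1 else -1 with hε
  have hrec : ∀ m, ∀ t ∈ Set.Ioo p q, xi t m = b m + ε m * t⁻¹ * xi t (m+1) := by
    intro m t ht
    have ht0 : 0 < t := by linarith [ht.1]
    have h1 : xi t (m+1) = tent t (xi t m) := by rw [add_comm, xi_add]; rfl
    rw [h1, tent_eq ht0.le]
    by_cases h : P m
    · obtain ⟨s, hs, hs'⟩ := h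
      have h2 := hc m s hs t ht hs'
      have h3 : P m := ⟨s, hs, hs'⟩
      simp only [hb, hε, if_pos h3]
      rw [abs_of_nonpos (by linarith)]; field_simp; ring
    · simp only [hb, hε, if_neg h]
      have h2 : 1/2 ≤ xi t m := by
        by_contra h3
        push Not at h3
        exact h ⟨t, ht, h3⟩
      rw [abs_of_nonneg (by linarith)]; field_simp; ring
  set β : ℕ → ℝ := fun k => ∏ i ∈ Finset.range k, ε i with hβ
  have hβabs : ∀ k, |β k| = 1 := by
    intro k
    simp only [hβ, Finset.abs_prod]
    apply Finset.prod_eq_one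
    intro i _
    simp only [hε]; split_ifs <;> simp
  set α : ℕ → ℝ := fun k => β k * b k with hα
  have hα1 : ∀ k, |α k| ≤ 1 := by
    intro k
    simp only [hα, abs_mul, hβabs, one_mul, hb]
    split_ifs <;> simp
  have hpart : ∀ t ∈ Set.Ioo p q, ∀ N, ∑ k ∈ Finset.range N, α k * (t⁻¹)^k
      = 1/2 - β N * (t⁻¹)^N * xi t N := by
    intro t ht N
    induction N with
    | zero => simp [hβ, xi_zero]
    | succ N ih =>
      rw [Finset.sum_range_succ, ih]
      have h1 := hrec N t ht
      have h2 : β (N+1) = β N * ε N := by simp only [hβ, Finset.prod_range_succ]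
      rw [h2, pow_succ]
      simp only [hα]
      linear_combination (-(β N * (t⁻¹)^N)) * h1
  have hsum : ∀ t ∈ Set.Ioo p q, ∑' k, α k * (t⁻¹)^k = 1/2 := by
    intro t ht
    have ht0 : 1 < t := by linarith [ht.1]
    have hz0 : 0 < t⁻¹ := by positivity
    have hz1 : t⁻¹ < 1 := inv_lt_one_of_one_lt₀ ht0
    have hs : Summable fun k => α k * (t⁻¹)^k := by
      apply Summable.of_norm_bounded (summable_geometric_of_lt_one hz0.le hz1)
      intro k
      rw [norm_mul, Real.norm_eq_abs, Real.norm_eq_abs, abs_of_pos (pow_pos hz0 k)]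
      nlinarith [hα1 k, pow_pos hz0 k]
    have hl := hs.hasSum.tendsto_sum_nat
    refine tendsto_nhds_unique hl ?_
    have h0 : Filter.Tendsto (fun N => β N * (t⁻¹)^N * xi t N) Filter.atTop (nhds 0) := by
      apply squeeze_zero_norm (a := fun N => (t⁻¹)^N) _
        (tendsto_pow_atTop_nhds_zero_of_lt_one hz0.le hz1)
      intro N
      have hm := xi_mem (by linarith : 0 ≤ t) (by linarith [ht.2]) N
      rw [norm_mul, norm_mul, Real.norm_eq_abs, Real.norm_eq_abs, Real.norm_eq_abs, hβabs,
        abs_of_pos (pow_pos hz0 N), abs_of_nonneg hm.1]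
      nlinarith [hm.2, pow_pos hz0 N]
    have h1 := h0.const_sub (1/2)
    rw [sub_zero] at h1
    exact h1.congr fun N => (hpart t ht N).symm
  have hp0 : 0 < p := by linarith
  have hq0 : 0 < q := by linarith
  have := power_id α hα1 (x := q⁻¹) (y := p⁻¹) (by positivity) (by gcongr)
    (inv_lt_one_of_one_lt₀ hp) (by
    intro z hz
    have hz0 : 0 < z := lt_trans (by positivity) hz.1
    have := hsum z⁻¹ ⟨(lt_inv_comm₀ hz0 hp0).1 hz.2, (inv_lt_comm₀ hq0 hz0).1 hz.1⟩
    rwa [inv_inv] at this)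
  simp only [hα, hβ, hb, Finset.range_zero, Finset.prod_empty, one_mul] at this
  split_ifs at this <;> norm_num at this

lemma two_sided {x y : ℝ} (hx : 1 < x) (hxy : x < y) (hy : y ≤ 2) :
    ∃ a ∈ Set.Ioo x y, ∃ n, 0 < n ∧ xi a n = 1/2 ∧
      (∀ ε > 0, ∃ t, |t - a| < ε ∧ xi t n < 1/2) ∧ (∀ ε > 0, ∃ t, |t - a| < ε ∧ 1/2 < xi t n) := by
  classical
  have hex := id_lemma hx hxy hy
  set n := Nat.find hex with hn
  obtain ⟨s, hs, t, ht, hsn, htn⟩ := Nat.find_spec hex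
  rw [← hn] at hsn htn
  have hmin : ∀ m < n, ¬ ∃ s ∈ Set.Ioo x y, ∃ t ∈ Set.Ioo x y, xi s m < 1/2 ∧ 1/2 < xi t m :=
    fun m hm => Nat.find_min hex hm
  have hn0 : 0 < n := by
    rcases Nat.eq_zero_or_pos n with h | h
    · rw [h, xi_zero] at hsn; exact absurd hsn (lt_irrefl _)
    · exact h
  by_contra hc
  push Not at hc
  have hcont := xi_cont n
  have hsub : Set.uIcc s t ⊆ Set.Ioo x y := by
    intro r hr
    rw [Set.mem_uIcc] at hr
    rcases hr with h | h
    · exact ⟨by linarith [hs.1], by linarith [ht.2]⟩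
    · exact ⟨by linarith [ht.1], by linarith [hs.2]⟩
  have hU : ∀ r, xi r n < 1/2 → r ∈ interior {r | xi r n ≤ 1/2} := fun r hr =>
    mem_interior.2 ⟨{r | xi r n < 1/2}, fun s hs => (by
      have h1 : xi s n < 1/2 := hs
      exact (show xi s n ≤ 1/2 from h1.le)), isOpen_lt hcont continuous_const, hr⟩
  have hV : ∀ r, 1/2 < xi r n → r ∈ interior {r | 1/2 ≤ xi r n} := fun r hr =>
    mem_interior.2 ⟨{r | 1/2 < xi r n}, fun s hs => (by
      have h1 : 1/2 < xi s n := hs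
      exact (show 1/2 ≤ xi s n from h1.le)), isOpen_lt continuous_const hcont, hr⟩
  have hcov : Set.uIcc s t ⊆ interior {r | xi r n ≤ 1/2} ∪ interior {r | 1/2 ≤ xi r n} := by
    intro r hr
    rcases lt_trichotomy (xi r n) (1/2) with h | h | h
    · exact Or.inl (hU r h)
    · by_cases h1 : ∀ ε > 0, ∃ t, |t - r| < ε ∧ xi t n < 1/2
      · obtain ⟨ε, hε, h2⟩ := hc r (hsub hr) n hn0 h h1
        left
        rw [mem_interior_iff_mem_nhds, Metric.mem_nhds_iff]
        exact ⟨ε, hε, fun s hs => h2 s hs⟩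
      · push Not at h1
        obtain ⟨ε, hε, h2⟩ := h1
        right
        rw [mem_interior_iff_mem_nhds, Metric.mem_nhds_iff]
        exact ⟨ε, hε, fun s hs => h2 s hs⟩
    · exact Or.inr (hV r h)
  obtain ⟨r, hr, hr1, hr2⟩ := isPreconnected_uIcc _ _ isOpen_interior isOpen_interior hcov
    ⟨s, Set.left_mem_uIcc, hU s hsn⟩ ⟨t, Set.right_mem_uIcc, hV t htn⟩
  have hnh := Filter.inter_mem (Filter.inter_mem (mem_interior_iff_mem_nhds.1 hr1) (mem_interior_iff_mem_nhds.1 hr2))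
    (isOpen_Ioo.mem_nhds (hsub hr))
  obtain ⟨ε, hε, hball⟩ := Metric.mem_nhds_iff.1 hnh
  have hin : ∀ v ∈ Set.Ioo (r - ε) (r + ε), xi v n = 1/2 ∧ v ∈ Set.Ioo x y := by
    intro v hv
    have h1 : v ∈ Metric.ball r ε := by
      rw [Real.ball_eq_Ioo]; exact hv
    obtain ⟨⟨h2, h3⟩, h4⟩ := hball h1
    have h2' : xi v n ≤ 1/2 := h2
    have h3' : 1/2 ≤ xi v n := h3
    exact ⟨le_antisymm h2' h3', h4⟩
  have hr' := hsub hr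
  obtain ⟨m, s', hs', t', ht', e1, e2⟩ := id_lemma (p := max r x) (q := min (r+ε) y)
    (lt_of_lt_of_le hx (le_max_right _ _))
    (max_lt (lt_min (by linarith) hr'.2) (lt_min (by linarith [hr'.1]) hxy))
    ((min_le_right _ _).trans hy)
  have hs2 := hin s' ⟨by linarith [hs'.1, le_max_left r x], lt_of_lt_of_le hs'.2 (min_le_left _ _)⟩
  have ht2 := hin t' ⟨by linarith [ht'.1, le_max_left r x], lt_of_lt_of_le ht'.2 (min_le_left _ _)⟩
  rw [xi_mod hs2.1] at e1
  rw [xi_mod ht2.1] at e2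
  exact hmin (m % n) (Nat.mod_lt _ hn0) ⟨s', hs2.2, t', ht2.2, e1, e2⟩

lemma pow_gt_four {a : ℝ} (ha : Real.sqrt 2 < a) (ha2 : a < 2) {n : ℕ} (hn : 0 < n)
    (hper : xi a n = 1/2) : 4 < a^n := by
  have h14 := sqrt2_lb ha
  have ha0 : 0 ≤ a := by linarith
  have x1 := xi_one ha0
  have x2 : xi a 2 = a * (2 - a) / 2 := by
    rw [show (2:ℕ) = 1 + 1 from rfl, xi_add, x1]
    simp only [Function.iterate_one]
    rw [tent_eq ha0, abs_of_pos (by linarith)]; ring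
  have x2' : xi a 2 < 1/2 := by rw [x2]; nlinarith [sq_nonneg (a-1)]
  have x3 : xi a 3 = a * xi a 2 := by
    rw [show (3:ℕ) = 1 + 2 from rfl, xi_add]
    simp only [Function.iterate_one]
    rw [tent_eq ha0, abs_of_neg (by linarith)]; ring
  have hsq : 2 < a^2 := by
    have := Real.sq_sqrt (show (0:ℝ) ≤ 2 by norm_num)
    nlinarith [Real.sqrt_nonneg 2]
  rcases lt_or_ge n 4 with h | h
  · interval_cases n
    · rw [x1] at hper; linarith
    · linarith
    · rw [x3, x2] at hper
      have h1 : (a - 1) * (a^2 - a - 1) = 0 := by nlinarith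
      have h2 : a^2 - a - 1 = 0 := by
        rcases mul_eq_zero.1 h1 with h | h
        · linarith
        · exact h
      have h3 : 1.5 < a := by nlinarith
      nlinarith
  · have h1 : a^4 ≤ a^n := pow_le_pow_right₀ (by linarith) h
    nlinarith

lemma exists_pre {a : ℝ} (ha : Real.sqrt 2 < a) (ha2 : a < 2) {τ D : ℝ} (hτ : τ = 1 ∨ τ = -1)
    (hD : 0 < D) (hD2 : D ≤ 1/2) : ∃ d, 0 < d ∧ d ≤ D ∧ ∃ M, (tent a)^[M] (1/2 + τ * d) = 1/2 := by
  by_contra hc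
  push Not at hc
  have h14 := sqrt2_lb ha
  have ha0 : 0 ≤ a := by linarith
  have hside : ∀ i, 0 < ((tent a)^[i] (1/2 + τ * D) - 1/2) * ((tent a)^[i] (1/2 + τ * (D/2)) - 1/2) := by
    intro i
    refine same_sign_seg (fun d => (tent a)^[i] (1/2 + τ * d) - 1/2) ?_ D (D/2) ?_
      Set.left_mem_uIcc Set.right_mem_uIcc
    · have := iter_cont' a i
      fun_prop
    · intro d hd
      rw [Set.uIcc_of_ge (by linarith)] at hd
      exact sub_ne_zero.2 (hc d (by linarith [hd.1]) hd.2 i)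
  obtain ⟨k, hk⟩ := pow_unbounded_of_one_lt (2/D) (by linarith : 1 < a)
  have h1 := affine ha0 k _ _ (fun i _ => hside i)
  have m1 := iter_mem ha0 ha2.le (x := 1/2 + τ * D) (by
    rcases hτ with h | h <;> rw [h] <;> constructor <;> linarith) k
  have m2 := iter_mem ha0 ha2.le (x := 1/2 + τ * (D/2)) (by
    rcases hτ with h | h <;> rw [h] <;> constructor <;> linarith) k
  rw [div_lt_iff₀ hD] at hk
  have h2 : 1/2 + τ * D - (1/2 + τ * (D/2)) = τ * (D/2) := by ring
  rw [h2] at h1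
  have h3 := m1.1; have h4 := m1.2; have h5 := m2.1; have h6 := m2.2
  rcases sg_cases a (1/2 + τ * (D/2)) k with h | h <;> rw [h] at h1 <;>
    rcases hτ with h' | h' <;> rw [h'] at h1 h3 h4 h5 h6 <;> linarith

lemma base {x y : ℝ} (hx : Real.sqrt 2 ≤ x) (hxy : x < y) (hy : y ≤ 2) :
    ∃ a ∈ Set.Ioo x y, ∃ n M τ d, Weak a n M τ d := by
  classical
  have hx1 : 1 < x := lt_of_lt_of_le (by
    rw [Real.lt_sqrt (by norm_num)]; norm_num) hx
  obtain ⟨a, haxy, N, hN, hperN, hlt, hgt⟩ := two_sided hx1 hxy hy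
  refine ⟨a, haxy, ?_⟩
  have ha : Real.sqrt 2 < a := lt_of_le_of_lt hx haxy.1
  have ha2 : a < 2 := lt_of_lt_of_le haxy.2 hy
  have h14 := sqrt2_lb ha
  have ha0 : 0 ≤ a := by linarith
  have hPN : Function.IsPeriodicPt (tent a) N (1/2) := hperN
  set n := Function.minimalPeriod (tent a) (1/2) with hn
  have hn0 : 0 < n := hPN.minimalPeriod_pos hN
  have hper : xi a n = 1/2 := Function.isPeriodicPt_minimalPeriod (tent a) (1/2)
  obtain ⟨j, hj⟩ : n ∣ N := hPN.minimalPeriod_dvd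
  have hne : ∀ l, 0 < l → l < n → xi a l ≠ 1/2 := by
    intro l h0 hl h
    have : Function.IsPeriodicPt (tent a) l (1/2) := h
    exact absurd (this.minimalPeriod_le h0) (by omega)
  set τ := -sg a (a/2) (n-1) with hτd
  have hτ : τ = 1 ∨ τ = -1 := by
    rcases sg_cases a (a/2) (n-1) with h | h <;> rw [hτd, h] <;> norm_num
  have hττ : τ * τ = 1 := by rcases hτ with h | h <;> rw [h] <;> norm_num
  have hτabs : |τ| = 1 := by rcases hτ with h | h <;> rw [h] <;> norm_num
  obtain ⟨D0, hD0, hDl0⟩ := exists_pos_lb (fun l => if l = 0 then 1 else |xi a l - 1/2|) n (by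
    intro l hl
    by_cases h : l = 0
    · simp [h]
    · simp only [if_neg h]
      exact abs_pos.2 (sub_ne_zero.2 (hne l (by omega) hl)))
  set D := min D0 (1/2) with hD
  have hDpos : 0 < D := lt_min hD0 (by norm_num)
  have hDl : ∀ l, 0 < l → l < n → D ≤ |xi a l - 1/2| := by
    intro l h0 hl
    have := hDl0 l hl
    simp only [if_neg (by omega : ¬ l = 0)] at this
    exact (min_le_left _ _).trans this
  obtain ⟨d, hd0, hdD, hM⟩ := exists_pre ha ha2 hτ hDpos (min_le_right _ _)
  have hpow : 0 < a^n := by positivity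
  refine ⟨n, Nat.find hM, τ, d, ha, ha2, hn0, ?_, hτ, hd0, hper, fun l h0 hl => hdD.trans (hDl l h0 hl),
    Nat.find_spec hM, fun l hl => Nat.find_min hM hl, ?_, ?_, pow_gt_four ha ha2 hn0 hper⟩
  · rw [Nat.find_pos]
    simp only [Function.iterate_zero, id]
    intro h
    have : τ * d = 0 := by linarith
    rcases mul_eq_zero.1 this with h | h
    · rw [h] at hττ; norm_num at hττ
    · linarith
  · -- availability of the right sign
    by_contra hc
    push Not at hc
    obtain ⟨ε, hε, hc⟩ := hc
    obtain ⟨δ, hδ, hjoint⟩ := joint a (1/2) (D/4) (by linarith) n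
    obtain ⟨δ', hδ', hjoint'⟩ := joint a (1/2) δ hδ N
    set r := min (min ε (a - Real.sqrt 2)) (min δ δ') with hr
    have hrpos : 0 < r := lt_min (lt_min hε (by linarith)) (lt_min hδ hδ')
    have r1 : r ≤ ε := (min_le_left _ _).trans (min_le_left _ _)
    have r2 : r ≤ a - Real.sqrt 2 := (min_le_left _ _).trans (min_le_right _ _)
    have r3 : r ≤ δ := (min_le_right _ _).trans (min_le_left _ _)
    have r4 : r ≤ δ' := (min_le_right _ _).trans (min_le_right _ _)
    have key : ∀ t, |t - a| < r → 0 ≤ τ * (xi t N - 1/2) := by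
      intro t ht
      have ht14 := sqrt2_lb (show Real.sqrt 2 < t by linarith [(abs_lt.1 ht).1])
      have ht0 : 0 ≤ t := by linarith
      have hxl : ∀ l ≤ n, |xi t l - xi a l| < D/4 := fun l hl =>
        hjoint t (1/2) (ht.trans_le r3) (by simpa using hδ) l hl
      have hsg : sg t (t/2) (n-1) = -τ := by
        rw [hτd, neg_neg]
        apply sg_congr_xi ht0 ha0
        intro l h0 hl
        exact same_side (hxl l hl.le).le (by linarith [hDl l h0 hl])
      have hloc : ∀ x, |x| < δ → (tent t)^[n] (1/2 + x) = xi t n + τ * (t^n * |x|) := by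
        intro x hx
        have hf := fold ht0 n hn0 x (by
          intro l h0 hl
          have e1 := hjoint t (1/2 + x) (ht.trans_le r3) (by simpa using hx) l hl.le
          have e2 := hxl l hl.le
          have e3 := abs_sub_le ((tent t)^[l] (1/2 + x)) ((tent a)^[l] (1/2)) (xi t l)
          have e4 := hDl l h0 hl
          have e5 := abs_sub_le (xi a l) (xi t l) (1/2)
          rw [abs_sub_comm (xi a l) (xi t l)] at e5
          have e6 : |(tent a)^[l] (1/2) - xi t l| < D/4 := by rw [abs_sub_comm]; exact e2
          refine same_side (r := D/2) (by linarith) (by linarith))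
        rw [hf, hsg]; ring
      have hc' := hc t (ht.trans_le r1)
      have hind : ∀ k, k + 1 ≤ j → 0 ≤ τ * (xi t ((k+1)*n) - 1/2) := by
        intro k
        induction k with
        | zero => intro _; simpa using hc'
        | succ k ih =>
          intro hk
          have e1 : (k+1)*n ≤ N := by
            rw [hj, mul_comm n j]; exact Nat.mul_le_mul_right n (by omega)
          have e2 := hjoint' t (1/2) (ht.trans_le r4) (by simpa using hδ') _ e1
          have e3 : (tent a)^[(k+1)*n] (1/2) = 1/2 := by
            have := xi_mod hper ((k+1)*n)
            rw [Nat.mul_mod_left] at this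
            exact this
          rw [e3] at e2
          have e4 := hloc (xi t ((k+1)*n) - 1/2) e2
          rw [add_sub_cancel, ← xi_add] at e4
          rw [show (k+1+1)*n = n + (k+1)*n by ring, e4]
          have e5 : 0 ≤ t^n * |xi t ((k+1)*n) - 1/2| := by positivity
          have : τ * (xi t n + τ * (t^n * |xi t ((k+1)*n) - 1/2|) - 1/2) =
            τ * (xi t n - 1/2) + (τ * τ) * (t^n * |xi t ((k+1)*n) - 1/2|) := by ring
          rw [this, hττ]; linarith
      have hj0 : 0 < j := by
        rcases Nat.eq_zero_or_pos j with h | h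
        · rw [h] at hj; omega
        · exact h
      have := hind (j-1) (by omega)
      rwa [show (j-1+1)*n = N by rw [hj, Nat.sub_add_cancel hj0, mul_comm]] at this
    obtain ⟨t1, ht1, ht1'⟩ := hlt r hrpos
    obtain ⟨t2, ht2, ht2'⟩ := hgt r hrpos
    have k1 := key t1 ht1
    have k2 := key t2 ht2
    rcases hτ with h | h <;> rw [h] at k1 k2 <;> linarith
  · have hab : a^n * |τ * (d / a^n)| = d := by
      rw [abs_mul, hτabs, abs_of_pos (div_pos hd0 hpow)]; field_simp
    have hf := fold ha0 n hn0 (τ * (d / a^n)) (by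
      intro l h0 hl
      have h1 := near ha hl (τ * (d / a^n))
      rw [hab] at h1
      exact same_side h1 (by linarith [hDl l h0 hl]))
    rw [hf, hper, mul_assoc, hab, hτd]; ring

end TentAux

/-- There is a locally uncountable dense set `A ⊆ [√2, 2]` of parameters such that for
every `a ∈ A`, the omega-limit set `ω(c)` of the turning point `c = 1/2` under the tent
map `T_a` is an infinite compact set and `T_a : ω(c) → ω(c)` is a homeomorphism. -/
theorem exists_locally_uncountable_dense_parameter_set :
    ∃ A : Set ℝ, A ⊆ Set.Icc (Real.sqrt 2) 2 ∧
      (∀ x y : ℝ, Real.sqrt 2 ≤ x → x < y → y ≤ 2 → ¬(A ∩ Set.Ioo x y).Countable) ∧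
      ∀ a ∈ A,
        (omegaSet (tent a) (1 / 2)).Infinite ∧
        IsCompact (omegaSet (tent a) (1 / 2)) ∧
        ∃ h : ↥(omegaSet (tent a) (1 / 2)) ≃ₜ ↥(omegaSet (tent a) (1 / 2)),
          ∀ x : ↥(omegaSet (tent a) (1 / 2)), (h x : ℝ) = tent a x := by
  refine ⟨{a | a ∈ Set.Icc (Real.sqrt 2) 2 ∧ TentAux.Good a}, fun a ha => ha.1, ?_, ?_⟩
  · intro x y hx hxy hy hcount
    obtain ⟨a, haxy, n, M, τ, d, hw⟩ := TentAux.base hx hxy hy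
    obtain ⟨a', J, τ', d', η', h1, -, -, hs, -, -⟩ := TentAux.core hw (min (a - x) (y - a))
      (lt_min (by linarith [haxy.1]) (by linarith [haxy.2]))
    have h2 := abs_lt.1 h1
    have h3 := min_le_left (a - x) (y - a)
    have h4 := min_le_right (a - x) (y - a)
    have hp := fun b => TentAux.uncountable_piece x y hx hy a' _ τ' d' η' hs
      ⟨by linarith [h2.1], by linarith [h2.2]⟩ b
    obtain ⟨b, hb⟩ : ∃ b : ℕ → ℝ, {a | a ∈ Set.Icc (Real.sqrt 2) 2 ∧ TentAux.Good a} ∩ Set.Ioo x y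
        ⊆ Set.range b := by
      rcases Set.eq_empty_or_nonempty
        ({a | a ∈ Set.Icc (Real.sqrt 2) 2 ∧ TentAux.Good a} ∩ Set.Ioo x y) with h | h
      · exact ⟨fun _ => 0, by rw [h]; exact Set.empty_subset _⟩
      · obtain ⟨b, hb⟩ := hcount.exists_eq_range h
        exact ⟨b, hb.le⟩
    obtain ⟨α, hα, hg, hne⟩ := hp b
    obtain ⟨k, hk⟩ := hb ⟨⟨⟨by linarith [hα.1], by linarith [hα.2]⟩, hg⟩, hα⟩
    exact hne k hk.symm
  · intro a ha
    obtain ⟨⟨h1, h2⟩, hg⟩ := ha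
    refine TentAux.good_concl (le_trans ?_ h1) h2 hg
    rw [Real.le_sqrt' (by norm_num)]; norm_num
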